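/- arXiv:2207.12799 — 6 statements merged into one kernel-verified Lean document; each statement's English description precedes it below -/
import Mathlib

section
/- Let A be a unital commutative C*-algebra and let d, n be positive natural numbers. If (τ_j)_{j=1}^n and (ω_j)_{j=1}^n are both Parseval frames for the standard Hilbert A-module A^d, then in the canonical order of A one has ∑_{j=1}^n ⟨θ_τ τ_j − θ_ω ω_j, θ_τ τ_j − θ_ω ω_j⟩ ≤ 4 · ∑_{j=1}^n ⟨τ_j − ω_j, τ_j − ω_j⟩, where θ_τ, θ_ω : A^d → A^n are the analysis operators of the two frames. -/
open Finset

/-- The `A`-valued inner product on the standard Hilbert `A`-module `A^d`: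
`⟨x, y⟩ = ∑ i, x i * (y i)^*`. -/
def modInner {A : Type*} [Ring A] [StarRing A] {d : ℕ} (x y : Fin d → A) : A :=
  ∑ i, x i * star (y i)

/-- The analysis operator `θ_τ : A^d → A^n` of a family `τ` in `A^d`,
sending `x` to the tuple `(⟨x, τ_j⟩)_{j=1}^n`. -/
def analysisOp {A : Type*} [Ring A] [StarRing A] {d n : ℕ} (τ : Fin n → Fin d → A)
    (x : Fin d → A) : Fin n → A :=
  fun j => modInner x (τ j)

theorem modInner_sub_left {A : Type*} [Ring A] [StarRing A] {d : ℕ} (x y z : Fin d → A) :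
    modInner (x - y) z = modInner x z - modInner y z := by
  simp [modInner, sub_mul]

theorem modInner_sub_right {A : Type*} [Ring A] [StarRing A] {d : ℕ} (x y z : Fin d → A) :
    modInner x (y - z) = modInner x y - modInner x z := by
  simp [modInner, mul_sub]

theorem star_modInner {A : Type*} [Ring A] [StarRing A] {d : ℕ} (x y : Fin d → A) :
    star (modInner x y) = modInner y x := by
  simp [modInner]

/-- The parallelogram inequality in a star-ordered ring. -/
theorem add_mul_star_add_le {A : Type*} [Ring A] [PartialOrder A] [StarRing A]
    [StarOrderedRing A] (a b : A) :
    (a + b) * star (a + b) ≤ 2 • (a * star a) + 2 • (b * star b) := by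
  rw [← sub_nonneg]
  have key : 2 • (a * star a) + 2 • (b * star b) - (a + b) * star (a + b)
      = (a - b) * star (a - b) := by
    rw [star_add, star_sub]
    noncomm_ring
  rw [key]
  exact mul_star_self_nonneg _

/-- Let `A` be a unital commutative C*-algebra, `d, n > 0`.  If `τ` and `ω` are Parseval
frames for `A^d`, then `∑ j ⟨θ_τ τ_j - θ_ω ω_j, θ_τ τ_j - θ_ω ω_j⟩ ≤
4 ∑ j ⟨τ_j - ω_j, τ_j - ω_j⟩` in the canonical order of `A`. -/
theorem analysis_dist_le_four_smul_dist {A : Type*} [CommCStarAlgebra A] [PartialOrder A]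
    [StarOrderedRing A] {d n : ℕ} (hd : 0 < d) (hn : 0 < n)
    (τ ω : Fin n → Fin d → A)
    (hτ : ∀ x : Fin d → A,
      modInner x x = ∑ j, modInner x (τ j) * star (modInner x (τ j)))
    (hω : ∀ x : Fin d → A,
      modInner x x = ∑ j, modInner x (ω j) * star (modInner x (ω j))) :
    ∑ j, modInner (analysisOp τ (τ j) - analysisOp ω (ω j))
        (analysisOp τ (τ j) - analysisOp ω (ω j))
      ≤ 4 • ∑ j, modInner (τ j - ω j) (τ j - ω j) := by
  have entry (j k : Fin n) : (analysisOp τ (τ j) - analysisOp ω (ω j)) k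
      = modInner (τ j) (τ k - ω k) + modInner (τ j - ω j) (ω k) := by
    rw [modInner_sub_right, modInner_sub_left]
    simp [analysisOp]
  have norm_left : ∑ j, ∑ k, modInner (τ j) (τ k - ω k) * star (modInner (τ j) (τ k - ω k))
      = ∑ k, modInner (τ k - ω k) (τ k - ω k) := by
    rw [sum_comm]
    refine sum_congr rfl fun k _ => ?_
    rw [hτ (τ k - ω k)]
    refine sum_congr rfl fun j _ => ?_
    rw [star_modInner, star_modInner, mul_comm]
  have norm_right : ∑ j, ∑ k, modInner (τ j - ω j) (ω k) * star (modInner (τ j - ω j) (ω k))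
      = ∑ j, modInner (τ j - ω j) (τ j - ω j) :=
    sum_congr rfl fun j _ => (hω (τ j - ω j)).symm
  calc
    _ = ∑ j, ∑ k, (modInner (τ j) (τ k - ω k) + modInner (τ j - ω j) (ω k)) *
          star (modInner (τ j) (τ k - ω k) + modInner (τ j - ω j) (ω k)) := by
      simp only [← entry]
      rfl
    _ ≤ ∑ j, ∑ k, (2 • (modInner (τ j) (τ k - ω k) * star (modInner (τ j) (τ k - ω k))) +
          2 • (modInner (τ j - ω j) (ω k) * star (modInner (τ j - ω j) (ω k)))) :=
      sum_le_sum fun j _ => sum_le_sum fun k _ => add_mul_star_add_le _ _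
    _ = 4 • ∑ j, modInner (τ j - ω j) (τ j - ω j) := by
      simp only [sum_add_distrib, ← smul_sum]
      rw [norm_left, norm_right, ← add_smul]
end

section
/- Let A be a unital C*-algebra, let d, n be positive natural numbers, and let (τ_j)_{j=1}^n be a modular frame for A^d, i.e. there exist real numbers a, b > 0 with a⟨x,x⟩ ≤ ∑_{j=1}^n ⟨x,τ_j⟩⟨τ_j,x⟩ ≤ b⟨x,x⟩ for all x ∈ A^d. Then the frame homomorphism S_τ : A^d → A^d defined by S_τ x := ∑_{j=1}^n ⟨x,τ_j⟩ τ_j is an A-module map that is self-adjoint (⟨S_τ x, y⟩ = ⟨x, S_τ y⟩ for all x, y), positive (⟨S_τ x, x⟩ ≥ 0 in A for all x), and invertible (bijective). -/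
open Finset

/-- The frame homomorphism `S_τ : A^d → A^d`, `S_τ x = ∑ j, ⟨x, τ_j⟩ • τ_j`. -/
def frameOp {A : Type*} [Ring A] [StarRing A] {d n : ℕ} (τ : Fin n → Fin d → A)
    (x : Fin d → A) : Fin d → A :=
  ∑ j, modInner x (τ j) • τ j

namespace CStarAlgebra

variable {B : Type*} [CStarAlgebra B] [PartialOrder B] [StarOrderedRing B]

/-- A self-adjoint element is nonnegative if none of its conjugates `q * b * star q` is of the
form `-(r * star r)` with `r ≠ 0`. -/
theorem nonneg_of_forall_conjugate_eq_neg {b : B} (hb : IsSelfAdjoint b)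
    (h : ∀ q r : B, q * b * star q = -(r * star r) → r = 0) : 0 ≤ b := by
  set q : B := b⁻ with hq
  have hq0 : 0 ≤ q := CFC.negPart_nonneg b
  have hqs : star q = q := (IsSelfAdjoint.of_nonneg hq0).star_eq
  have hconj : q * b * star q = -(q * q * q) := by
    conv_lhs => rw [hqs, ← CFC.posPart_sub_negPart b hb, mul_sub, hq, CFC.negPart_mul_posPart]
    simp [hq]
  obtain ⟨s, hs⟩ := CStarAlgebra.nonneg_iff_eq_mul_star_self.1 hq0
  have hqqq : q * q * q = q * s * star (q * s) := by
    rw [star_mul, hqs, mul_assoc q s, ← mul_assoc s, ← hs, mul_assoc]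
  have hzero : q * q * q = 0 := by
    rw [hqqq, h q (q * s) (hconj.trans (congrArg Neg.neg hqqq)), zero_mul]
  have hqq : q * q = 0 := by
    rw [← CStarRing.mul_star_self_eq_zero_iff, star_mul, hqs, ← mul_assoc, hzero, zero_mul]
  have hqz : q = 0 := by
    rw [← CStarRing.mul_star_self_eq_zero_iff, hqs, hqq]
  exact (CFC.negPart_eq_zero_iff b hb).1 hqz

theorem isUnit_of_smul_one_le {b : B} {a : ℝ} (ha : 0 < a) (h : (a : ℂ) • (1 : B) ≤ b) :
    IsUnit b := by
  rw [Complex.coe_smul, ← Algebra.algebraMap_eq_smul_one] at h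
  exact CStarAlgebra.isUnit_of_le _ h (isStrictlyPositive_algebraMap ha)

end CStarAlgebra

namespace CStarMatrix

variable {n A : Type*} [Fintype n]

theorem mul_star_apply_self [NonUnitalSemiring A] [StarRing A]
    (M : CStarMatrix n n A) (i : n) :
    (M * star M) i i = ∑ k, M i k * star (M i k) := by
  simp [mul_apply, star_apply]

variable [CStarAlgebra A] [PartialOrder A] [StarOrderedRing A]

theorem eq_zero_of_mul_star_apply_self_nonpos {M : CStarMatrix n n A}
    (h : ∀ i, (M * star M) i i ≤ 0) : M = 0 := by
  ext i k
  have hsum : ∑ k, M i k * star (M i k) = 0 :=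
    le_antisymm (mul_star_apply_self M i ▸ h i)
      (Finset.sum_nonneg fun k _ => mul_star_self_nonneg (M i k))
  rw [Finset.sum_eq_zero_iff_of_nonneg fun k _ => mul_star_self_nonneg (M i k)] at hsum
  exact (CStarRing.mul_star_self_eq_zero_iff _).1 (hsum k (Finset.mem_univ k))

variable [DecidableEq n]

/-- A self-adjoint matrix over a C⋆-algebra whose quadratic form is nonnegative is nonnegative. -/
theorem nonneg_of_forall_sum_nonneg {M : CStarMatrix n n A} (hM : IsSelfAdjoint M)
    (h : ∀ v : n → A, 0 ≤ ∑ k, (∑ i, v i * M i k) * star (v k)) : 0 ≤ M := by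
  refine CStarAlgebra.nonneg_of_forall_conjugate_eq_neg hM fun Q R hQR =>
    eq_zero_of_mul_star_apply_self_nonpos fun i => ?_
  rw [← neg_nonneg, ← neg_apply, ← hQR]
  simpa [mul_apply, star_apply] using h (Q i)

/-- A self-adjoint matrix over a C⋆-algebra whose quadratic form is bounded below is invertible. -/
theorem isUnit_of_forall_smul_sum_le {M : CStarMatrix n n A} (hM : IsSelfAdjoint M) {a : ℝ}
    (ha : 0 < a)
    (h : ∀ v : n → A, (a : ℂ) • ∑ k, v k * star (v k) ≤ ∑ k, (∑ i, v i * M i k) * star (v k)) :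
    IsUnit M := by
  have hsa : IsSelfAdjoint ((a : ℂ) • (1 : CStarMatrix n n A)) :=
    .smul (Complex.conj_ofReal a) (.one _)
  refine CStarAlgebra.isUnit_of_smul_one_le ha (sub_nonneg.1 ?_)
  refine nonneg_of_forall_sum_nonneg (hM.sub hsa) fun v => ?_
  have hv : ∀ k, ∑ i, v i * (M - (a : ℂ) • (1 : CStarMatrix n n A)) i k =
      ∑ i, v i * M i k - (a : ℂ) • v k := fun k => by
    simp [-Complex.coe_smul, mul_sub, one_apply]
  simpa only [hv, sub_mul, Finset.sum_sub_distrib, smul_mul_assoc, ← Finset.smul_sum,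
    sub_nonneg] using h v

end CStarMatrix

theorem modInner_smul_add {A : Type*} [Ring A] [StarRing A] {d : ℕ} (c : A) (x y z : Fin d → A) :
    modInner (c • x + y) z = c * modInner x z + modInner y z := by
  simp [modInner, add_mul, Finset.sum_add_distrib, Finset.mul_sum, mul_assoc]

theorem frameOp_smul_add {A : Type*} [Ring A] [StarRing A] {d n : ℕ} (τ : Fin n → Fin d → A)
    (c : A) (x y : Fin d → A) : frameOp τ (c • x + y) = c • frameOp τ x + frameOp τ y := by
  simp [frameOp, modInner_smul_add, add_smul, mul_smul, Finset.sum_add_distrib, Finset.smul_sum]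

theorem modInner_frameOp_left {A : Type*} [Ring A] [StarRing A] {d n : ℕ} (τ : Fin n → Fin d → A)
    (x y : Fin d → A) :
    modInner (frameOp τ x) y = ∑ j, modInner x (τ j) * star (modInner y (τ j)) := by
  simp only [star_modInner]
  simp only [frameOp, modInner, Finset.sum_apply, Pi.smul_apply, smul_eq_mul, Finset.sum_mul]
  rw [Finset.sum_comm]
  simp only [Finset.mul_sum, mul_assoc]
  exact Finset.sum_congr rfl fun j _ => Finset.sum_comm

theorem modInner_frameOp_right {A : Type*} [Ring A] [StarRing A] {d n : ℕ} (τ : Fin n → Fin d → A)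
    (x y : Fin d → A) : modInner (frameOp τ x) y = modInner x (frameOp τ y) := by
  rw [← star_modInner (frameOp τ y) x]
  simp [modInner_frameOp_left]

/-- The matrix of the frame homomorphism, acting on row vectors from the right. -/
def frameMatrix {A : Type*} [Ring A] [StarRing A] {d n : ℕ} (τ : Fin n → Fin d → A) :
    Matrix (Fin d) (Fin d) A :=
  .of fun i k => ∑ j, star (τ j i) * τ j k

theorem frameOp_eq_vecMul {A : Type*} [Ring A] [StarRing A] {d n : ℕ} (τ : Fin n → Fin d → A)
    (x : Fin d → A) : frameOp τ x = Matrix.vecMul x (frameMatrix τ) := by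
  ext k
  simp only [frameOp, modInner, frameMatrix, Matrix.vecMul, dotProduct, Matrix.of_apply,
    Finset.sum_apply, Pi.smul_apply, smul_eq_mul, Finset.sum_mul, Finset.mul_sum, mul_assoc]
  exact Finset.sum_comm

theorem isHermitian_frameMatrix {A : Type*} [Ring A] [StarRing A] {d n : ℕ}
    (τ : Fin n → Fin d → A) : (frameMatrix τ).IsHermitian := by
  ext i k
  simp [frameMatrix]

theorem Matrix.vecMul_bijective_of_isUnit {m R : Type*} [Fintype m] [DecidableEq m] [Ring R]
    {M : Matrix m m R} (hM : IsUnit M) : Function.Bijective fun x : m → R => Matrix.vecMul x M := by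
  obtain ⟨u, rfl⟩ := hM
  refine Function.bijective_iff_has_inverse.2
    ⟨fun x => Matrix.vecMul x (u⁻¹ : (Matrix m m R)ˣ), fun x => ?_, fun x => ?_⟩ <;>
  simp [Matrix.vecMul_vecMul]

/-- Let `A` be a unital C*-algebra, `d, n > 0`, and let `τ` be a modular frame for `A^d`,
i.e. `a⟨x,x⟩ ≤ ∑ j ⟨x,τ_j⟩⟨τ_j,x⟩ ≤ b⟨x,x⟩` for some real `a, b > 0`.  Then the frame
homomorphism `S_τ` is an `A`-module map which is self-adjoint, positive, and bijective. -/
theorem frameOp_selfAdjoint_positive_invertible {A : Type*} [CStarAlgebra A] [PartialOrder A]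
    [StarOrderedRing A] {d n : ℕ} (hd : 0 < d) (hn : 0 < n)
    (τ : Fin n → Fin d → A) (a b : ℝ) (ha : 0 < a) (hb : 0 < b)
    (hframe : ∀ x : Fin d → A,
      (a : ℂ) • modInner x x ≤ ∑ j, modInner x (τ j) * star (modInner x (τ j)) ∧
      ∑ j, modInner x (τ j) * star (modInner x (τ j)) ≤ (b : ℂ) • modInner x x) :
    (∀ (c : A) (x y : Fin d → A),
        frameOp τ (c • x + y) = c • frameOp τ x + frameOp τ y) ∧
    (∀ x y : Fin d → A, modInner (frameOp τ x) y = modInner x (frameOp τ y)) ∧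
    (∀ x : Fin d → A, 0 ≤ modInner (frameOp τ x) x) ∧
    Function.Bijective (frameOp τ) := by
  refine ⟨frameOp_smul_add τ, modInner_frameOp_right τ, fun x => ?_, ?_⟩
  · rw [modInner_frameOp_left]
    exact Finset.sum_nonneg fun j _ => mul_star_self_nonneg _
  · have hunit : IsUnit (CStarMatrix.ofMatrix (frameMatrix τ)) := by
      refine CStarMatrix.isUnit_of_forall_smul_sum_le (isHermitian_frameMatrix τ) ha fun v => ?_
      have h := (hframe v).1
      rw [← modInner_frameOp_left, frameOp_eq_vecMul] at h
      exact h
    have hfun : frameOp τ = fun x => Matrix.vecMul x (frameMatrix τ) :=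
      funext (frameOp_eq_vecMul τ)
    rw [hfun]
    exact Matrix.vecMul_bijective_of_isUnit hunit
end

section
/- Let H be a real or complex Hilbert space, n a positive natural number, and let (τ_j)_{j=1}^n be a family in H with τ_j ≠ 0 for all j. Define ω_j := ((∑_{k=1}^n ‖τ_k‖)/n) · τ_j/‖τ_j‖ for each j. Then (ω_j)_{j=1}^n is the closest equal norm family to (τ_j)_{j=1}^n: for every family (v_j)_{j=1}^n in H whose members all have the same norm (‖v_j‖ = ‖v_k‖ for all j, k), one has ∑_{j=1}^n ‖τ_j − ω_j‖² ≤ ∑_{j=1}^n ‖τ_j − v_j‖². -/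
open Finset

/-- The arithmetic mean minimizes the sum of squared deviations. -/
theorem sum_sq_sub_mean_le {ι : Type*} [Fintype ι] (a : ι → ℝ) (r : ℝ) :
    ∑ j, (a j - (∑ k, a k) / Fintype.card ι) ^ 2 ≤ ∑ j, (a j - r) ^ 2 := by
  rcases isEmpty_or_nonempty ι with _ | _
  · simp
  set m := (∑ k, a k) / Fintype.card ι with hm
  have hsum : ∑ j, a j = Fintype.card ι * m := by
    rw [hm]
    field_simp
  have hdev : ∑ j, (a j - m) = 0 := by
    simp [Finset.sum_sub_distrib, hsum]
  calc ∑ j, (a j - m) ^ 2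
      ≤ ∑ j, (a j - m) ^ 2 + 2 * (m - r) * ∑ j, (a j - m) + ∑ _j : ι, (m - r) ^ 2 := by
        rw [hdev, mul_zero, add_zero]
        exact le_add_of_nonneg_right (Finset.sum_nonneg fun _ _ => sq_nonneg _)
    _ = ∑ j, (a j - r) ^ 2 := by
        rw [Finset.mul_sum, ← Finset.sum_add_distrib, ← Finset.sum_add_distrib]
        exact Finset.sum_congr rfl fun j _ => by ring

/-- The distance from a nonzero vector to its rescaling by `m / ‖x‖` is `|‖x‖ - m|`. -/
theorem norm_sub_ofReal_mul_inv_norm_smul (𝕜 : Type*) [RCLike 𝕜] {E : Type*}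
    [NormedAddCommGroup E] [NormedSpace 𝕜 E] {x : E} (hx : x ≠ 0) (m : ℝ) :
    ‖x - ((m : 𝕜) * ((‖x‖⁻¹ : ℝ) : 𝕜)) • x‖ = |‖x‖ - m| := by
  have hx' : ‖x‖ ≠ 0 := norm_ne_zero_iff.mpr hx
  have hsmul : x - ((m : 𝕜) * ((‖x‖⁻¹ : ℝ) : 𝕜)) • x = ((1 - m * ‖x‖⁻¹ : ℝ) : 𝕜) • x := by
    simp [sub_smul]
  rw [hsmul, norm_smul, RCLike.norm_ofReal]
  nth_rw 2 [← abs_norm x]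
  rw [← abs_mul, sub_mul, one_mul, inv_mul_cancel_right₀ hx']

/-- Closest equal norm family: let `H` be a real or complex inner product space (`𝕜` is
`ℝ` or `ℂ`), `n > 0`, and `τ_1, …, τ_n ∈ H` all nonzero.  Setting
`ω_j := ((∑ k ‖τ_k‖)/n) · τ_j/‖τ_j‖`, the family `ω` is the closest equal norm family to
`τ`: for every family `v` whose members all share the same norm,
`∑ j ‖τ_j - ω_j‖² ≤ ∑ j ‖τ_j - v_j‖²`. -/
theorem closest_equal_norm_family {𝕜 : Type*} [RCLike 𝕜] {H : Type*} [NormedAddCommGroup H]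
    [InnerProductSpace 𝕜 H] (n : ℕ) (hn : 0 < n) (τ : Fin n → H) (hτ : ∀ j, τ j ≠ 0)
    (ω : Fin n → H)
    (hω : ∀ j, ω j = ((((∑ k, ‖τ k‖) / n : ℝ) : 𝕜) * ((‖τ j‖⁻¹ : ℝ) : 𝕜)) • τ j) :
    ∀ v : Fin n → H, (∀ j k, ‖v j‖ = ‖v k‖) →
      ∑ j, ‖τ j - ω j‖ ^ 2 ≤ ∑ j, ‖τ j - v j‖ ^ 2 := by
  intro v hv
  let r := ‖v ⟨0, hn⟩‖
  have hτω : ∀ j, ‖τ j - ω j‖ ^ 2 = (‖τ j‖ - (∑ k, ‖τ k‖) / n) ^ 2 := fun j => by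
    rw [hω j, norm_sub_ofReal_mul_inv_norm_smul 𝕜 (hτ j), sq_abs]
  have hτv : ∀ j, (‖τ j‖ - r) ^ 2 ≤ ‖τ j - v j‖ ^ 2 := fun j => by
    have h := abs_norm_sub_norm_le (τ j) (v j)
    rw [hv j ⟨0, hn⟩] at h
    exact sq_le_sq.mpr (h.trans (le_abs_self _))
  calc ∑ j, ‖τ j - ω j‖ ^ 2 = ∑ j, (‖τ j‖ - (∑ k, ‖τ k‖) / n) ^ 2 :=
        Finset.sum_congr rfl fun j _ => hτω j
    _ ≤ ∑ j, (‖τ j‖ - r) ^ 2 := by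
        simpa using sum_sq_sub_mean_le (fun j => ‖τ j‖) r
    _ ≤ ∑ j, ‖τ j - v j‖ ^ 2 := Finset.sum_le_sum fun j _ => hτv j
end

section
/- Let (τ_j)_{j=1}^n be a frame for a d-dimensional real Hilbert space H with frame operator S_τ, and let T : H → H be the positive self-adjoint operator with T ∘ T ∘ S_τ = I (i.e. T = S_τ^{−1/2}). Then (T τ_j)_{j=1}^n is a Parseval frame for H, and it is the closest Parseval frame to (τ_j)_{j=1}^n: for every Parseval frame (ω_j)_{j=1}^n for H, ∑_{j=1}^n ‖T τ_j − τ_j‖² ≤ ∑_{j=1}^n ‖τ_j − ω_j‖², with equality only if ω_j = T τ_j for all j (unique minimizer). -/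
open Finset RealInnerProductSpace

/-- For a symmetric operator `A`, the sum `∑ j, ⟪A ω_j, ω_j⟫` takes the same value on all Parseval
frames (it is the trace of `A`). -/
theorem sum_inner_map_self_eq_of_parseval {H ι κ : Type*} [NormedAddCommGroup H]
    [InnerProductSpace ℝ H] [Fintype ι] [Fintype κ] {A : H →ₗ[ℝ] H} (hA : A.IsSymmetric)
    {ω : ι → H} {p : κ → H} (hω : ∀ x : H, ∑ j, ⟪x, ω j⟫ • ω j = x)
    (hp : ∀ x : H, ∑ k, ⟪x, p k⟫ • p k = x) :
    ∑ j, ⟪A (ω j), ω j⟫ = ∑ k, ⟪A (p k), p k⟫ := by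
  have expand_left (j : ι) : ⟪A (ω j), ω j⟫ = ∑ k, ⟪ω j, p k⟫ * ⟪A (ω j), p k⟫ := by
    conv_lhs => rw [← congrArg (⟪A (ω j), ·⟫) (hp (ω j))]
    simp only [inner_sum, real_inner_smul_right]
  have expand_right (k : κ) : ⟪A (p k), p k⟫ = ∑ j, ⟪ω j, p k⟫ * ⟪A (ω j), p k⟫ := by
    conv_lhs => rw [hA, ← congrArg (⟪·, A (p k)⟫) (hω (p k))]
    simp only [sum_inner, real_inner_smul_left, real_inner_comm (ω _) (p k), hA (ω _) (p k)]
  simp_rw [expand_left, expand_right]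
  exact sum_comm

/-- If a positive operator has vanishing quadratic form at `y`, then it annihilates `y`. -/
theorem map_eq_zero_of_inner_map_self_eq_zero {H : Type*} [NormedAddCommGroup H]
    [InnerProductSpace ℝ H] {T : H →ₗ[ℝ] H} (hT : T.IsSymmetric) (hpos : ∀ x, 0 ≤ ⟪T x, x⟫)
    {y : H} (hy : ⟪T y, y⟫ = 0) : T y = 0 := by
  have h := discrim_le_zero (a := ⟪T (T y), T y⟫) (b := 2 * ⟪T y, T y⟫) (c := 0) fun t => by
    have h := hpos (y + t • T y)
    simp only [map_add, map_smul, inner_add_left, inner_add_right, real_inner_smul_left,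
      real_inner_smul_right, hy, hT (T y) y] at h
    linarith
  rw [discrim] at h
  have : ⟪T y, T y⟫ = 0 := by nlinarith
  exact inner_self_eq_zero.mp this

/-- If `p` and `ω` are Parseval frames and `P` is symmetric, the excess of the squared distance from
`P p` to `ω` over that from `P p` to `p` is the quadratic form of `P` summed over `p - ω`. -/
theorem sum_norm_sub_sq_eq_add_of_parseval {H ι : Type*} [NormedAddCommGroup H]
    [InnerProductSpace ℝ H] [Fintype ι] {P : H →ₗ[ℝ] H} (hP : P.IsSymmetric)
    {p ω : ι → H} (hp : ∀ x : H, ∑ j, ⟪x, p j⟫ • p j = x)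
    (hω : ∀ x : H, ∑ j, ⟪x, ω j⟫ • ω j = x) :
    ∑ j, ‖P (p j) - ω j‖ ^ 2 =
      ∑ j, ‖p j - P (p j)‖ ^ 2 + ∑ j, ⟪P (p j - ω j), p j - ω j⟫ := by
  have hquad := sum_inner_map_self_eq_of_parseval hP hω hp
  have hnorm := sum_inner_map_self_eq_of_parseval LinearMap.IsSymmetric.id hω hp
  have hterm (j : ι) : ‖P (p j) - ω j‖ ^ 2 =
      ‖p j - P (p j)‖ ^ 2 + ⟪P (p j - ω j), p j - ω j⟫
        + (⟪P (p j), p j⟫ - ⟪P (ω j), ω j⟫) + (⟪ω j, ω j⟫ - ⟪p j, p j⟫) := by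
    have h : ⟪P (ω j), p j⟫ = ⟪P (p j), ω j⟫ := by rw [hP, real_inner_comm]
    simp only [← real_inner_self_eq_norm_sq, map_sub, inner_sub_left, inner_sub_right, h,
      real_inner_comm (P (p j)) (p j), real_inner_comm (P (p j)) (ω j)]
    ring
  simp only [LinearMap.id_apply] at hnorm
  simp_rw [hterm, sum_add_distrib, sum_sub_distrib, hquad, hnorm]
  ring

/-- Closest Parseval frame: let `τ` be a frame for a `d`-dimensional real Hilbert space
`H` (its frame operator `S_τ` is positive definite), and let `T` be the positive
self-adjoint operator with `T ∘ T ∘ S_τ = I`, i.e. `T = S_τ^{-1/2}`.  Then `(T τ_j)_j` is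
a Parseval frame for `H` and is the unique closest Parseval frame to `τ`. -/
theorem closest_parseval_frame {H : Type*} [NormedAddCommGroup H] [InnerProductSpace ℝ H]
    [FiniteDimensional ℝ H] (n d : ℕ) (hn : 0 < n) (hdim : Module.finrank ℝ H = d)
    (τ : Fin n → H)
    (hframe : ∀ x : H, x ≠ 0 → 0 < ∑ j, ⟪x, τ j⟫ ^ 2)
    (T : H →ₗ[ℝ] H)
    (hTadj : ∀ x y : H, ⟪T x, y⟫ = ⟪x, T y⟫)
    (hTpos : ∀ x : H, 0 ≤ ⟪T x, x⟫)
    (hTinv : ∀ x : H, T (T (∑ j, ⟪x, τ j⟫ • τ j)) = x) :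
    (∀ x : H, ∑ j, ⟪x, T (τ j)⟫ • T (τ j) = x) ∧
    (∀ ω : Fin n → H, (∀ x : H, ∑ j, ⟪x, ω j⟫ • ω j = x) →
      ∑ j, ‖T (τ j) - τ j‖ ^ 2 ≤ ∑ j, ‖τ j - ω j‖ ^ 2) ∧
    (∀ ω : Fin n → H, (∀ x : H, ∑ j, ⟪x, ω j⟫ • ω j = x) →
      ∑ j, ‖T (τ j) - τ j‖ ^ 2 = ∑ j, ‖τ j - ω j‖ ^ 2 →
      ∀ j, ω j = T (τ j)) := by
  have hinj : Function.Injective T :=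
    LinearMap.injective_iff_surjective.mpr fun x => ⟨_, hTinv x⟩
  have hparseval (x : H) : ∑ j, ⟪x, T (τ j)⟫ • T (τ j) = x := by
    apply hinj
    simpa only [map_sum, map_smul, hTadj] using hTinv (T x)
  let e : H ≃ₗ[ℝ] H := LinearEquiv.ofInjectiveEndo T hinj
  let P : H →ₗ[ℝ] H := e.symm
  have hTP (x : H) : T (P x) = x := e.apply_symm_apply x
  have hPT (x : H) : P (T x) = x := e.symm_apply_apply x
  have hPsymm : P.IsSymmetric := fun x y => by
    simpa only [hTP] using (hTadj (P x) (P y)).symm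
  have hPpos (x : H) : 0 ≤ ⟪P x, x⟫ := by
    simpa only [hTP, real_inner_comm] using hTpos (P x)
  have hexcess (ω : Fin n → H) (hω : ∀ x : H, ∑ j, ⟪x, ω j⟫ • ω j = x) :
      ∑ j, ‖τ j - ω j‖ ^ 2 =
        ∑ j, ‖T (τ j) - τ j‖ ^ 2 + ∑ j, ⟪P (T (τ j) - ω j), T (τ j) - ω j⟫ := by
    simpa only [hPT] using sum_norm_sub_sq_eq_add_of_parseval hPsymm hparseval hω
  refine ⟨hparseval, fun ω hω => ?_, fun ω hω heq j => ?_⟩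
  · rw [hexcess ω hω]
    exact le_add_of_nonneg_right (sum_nonneg fun j _ => hPpos _)
  · rw [hexcess ω hω, left_eq_add, sum_eq_zero_iff_of_nonneg fun j _ => hPpos _] at heq
    have hzero := map_eq_zero_of_inner_map_self_eq_zero hPsymm hPpos (heq j (mem_univ j))
    have hdiff := hTP (T (τ j) - ω j)
    rw [hzero, map_zero] at hdiff
    exact (sub_eq_zero.mp hdiff.symm).symm
end

section
/- (Paulsen problem implies projection problem, Hilbert space case.) Let ε ∈ (0,1), let n ≤ d be positive natural numbers, and let c ≥ 0. Suppose that every ε-nearly equal norm Parseval frame of d vectors in an n-dimensional real Hilbert space admits an equal norm Parseval frame of d vectors within squared distance at most c. Then for every d-dimensional real Hilbert space H with orthonormal basis (u_k)_{k=1}^d and every orthogonal projection P : H → H of rank n satisfying (1−ε)·n/d ≤ ‖P u_k‖² ≤ (1+ε)·n/d for all k, there exists an orthogonal projection Q : H → H with ‖Q u_k‖² = n/d for all 1 ≤ k ≤ d and ∑_{k=1}^d ‖P u_k − Q u_k‖² ≤ 4c. -/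
open Finset RealInnerProductSpace

/-- A linear map whose adjoint is a left inverse yields the orthogonal projection `S S†`. -/
theorem exists_projection_of_adjoint_leftInverse {E H : Type*}
    [NormedAddCommGroup E] [InnerProductSpace ℝ E] [FiniteDimensional ℝ E]
    [NormedAddCommGroup H] [InnerProductSpace ℝ H] [FiniteDimensional ℝ H]
    (S : E →ₗ[ℝ] H) (hS : ∀ x, S.adjoint (S x) = x) :
    ∃ Q : H →ₗ[ℝ] H, (∀ x, Q (Q x) = Q x) ∧ (∀ x y : H, ⟪Q x, y⟫ = ⟪x, Q y⟫) ∧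
      ∀ x, Q x = S (S.adjoint x) := by
  refine ⟨S ∘ₗ S.adjoint, fun x => ?_, fun x y => ?_, fun x => rfl⟩
  · simp [hS]
  · rw [LinearMap.comp_apply, LinearMap.comp_apply, ← LinearMap.adjoint_inner_right S,
      LinearMap.adjoint_inner_left]

/-- The analysis operator of a family of vectors, with values in a space with an orthonormal
basis indexed by the family. -/
noncomputable def analysisMap {ι E H : Type*} [Fintype ι]
    [NormedAddCommGroup E] [InnerProductSpace ℝ E]
    [NormedAddCommGroup H] [InnerProductSpace ℝ H]
    (b : OrthonormalBasis ι ℝ H) (ω : ι → E) : E →ₗ[ℝ] H :=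
  ∑ j, (innerₛₗ ℝ (ω j)).smulRight (b j)

section analysisMap

variable {ι E H : Type*} [Fintype ι]
  [NormedAddCommGroup E] [InnerProductSpace ℝ E]
  [NormedAddCommGroup H] [InnerProductSpace ℝ H]
  (b : OrthonormalBasis ι ℝ H) (ω : ι → E)

theorem analysisMap_apply (x : E) : analysisMap b ω x = ∑ j, ⟪ω j, x⟫ • b j := by
  simp [analysisMap]

theorem inner_analysisMap (x : E) (k : ι) : ⟪b k, analysisMap b ω x⟫ = ⟪ω k, x⟫ := by
  classical
  simp [analysisMap_apply, inner_sum, inner_smul_right, b.inner_eq_ite]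

theorem adjoint_analysisMap_basis [FiniteDimensional ℝ E] [FiniteDimensional ℝ H] (k : ι) :
    (analysisMap b ω).adjoint (b k) = ω k := by
  refine ext_inner_right ℝ fun x => ?_
  rw [LinearMap.adjoint_inner_left, inner_analysisMap]

theorem adjoint_analysisMap_leftInverse [FiniteDimensional ℝ E] [FiniteDimensional ℝ H]
    (hω : ∀ x : E, ∑ j, ⟪x, ω j⟫ • ω j = x) (x : E) :
    (analysisMap b ω).adjoint (analysisMap b ω x) = x := by
  rw [analysisMap_apply, map_sum]
  simpa [adjoint_analysisMap_basis, real_inner_comm] using hω x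

theorem norm_analysisMap_apply [FiniteDimensional ℝ E] [FiniteDimensional ℝ H]
    (hω : ∀ x : E, ∑ j, ⟪x, ω j⟫ • ω j = x) (x : E) : ‖analysisMap b ω x‖ = ‖x‖ := by
  rw [← sq_eq_sq₀ (norm_nonneg _) (norm_nonneg _), ← real_inner_self_eq_norm_sq,
    ← LinearMap.adjoint_inner_left, adjoint_analysisMap_leftInverse b ω hω,
    real_inner_self_eq_norm_sq]

/-- If `V` is the isometric embedding whose adjoint sends `b` to the Parseval frame `τ`, then the
Gram projections of the Parseval frames `τ` and `ω` differ by at most four times the squared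
distance between the frames. -/
theorem sum_norm_sub_analysisMap_sq_le [FiniteDimensional ℝ E] [FiniteDimensional ℝ H]
    (hω : ∀ x : E, ∑ j, ⟪x, ω j⟫ • ω j = x) (τ : ι → E)
    (hτ : ∀ x : E, ∑ j, ⟪x, τ j⟫ ^ 2 = ‖x‖ ^ 2)
    (V : E →ₗᵢ[ℝ] H) (hV : ∀ x j, ⟪b j, V x⟫ = ⟪τ j, x⟫) :
    ∑ k, ‖V (τ k) - analysisMap b ω (ω k)‖ ^ 2 ≤ 4 * ∑ k, ‖τ k - ω k‖ ^ 2 := by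
  have hcross : ∑ k, ‖V (τ k) - analysisMap b ω (τ k)‖ ^ 2 = ∑ k, ‖τ k - ω k‖ ^ 2 := by
    calc ∑ k, ‖V (τ k) - analysisMap b ω (τ k)‖ ^ 2
        = ∑ k, ∑ j, ⟪τ j - ω j, τ k⟫ ^ 2 := by
          refine Finset.sum_congr rfl fun k _ => ?_
          rw [← b.sum_sq_inner_right]
          simp only [inner_sub_right, inner_sub_left, hV, inner_analysisMap]
      _ = ∑ k, ‖τ k - ω k‖ ^ 2 := by
          rw [Finset.sum_comm]
          exact Finset.sum_congr rfl fun j _ => hτ _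
  have hpoint (k : ι) : ‖V (τ k) - analysisMap b ω (ω k)‖ ^ 2 ≤
      2 * ‖V (τ k) - analysisMap b ω (τ k)‖ ^ 2 + 2 * ‖τ k - ω k‖ ^ 2 := by
    have h := norm_add_le (V (τ k) - analysisMap b ω (τ k)) (analysisMap b ω (τ k - ω k))
    rw [norm_analysisMap_apply b ω hω, map_sub, sub_add_sub_cancel] at h
    nlinarith [norm_nonneg (V (τ k) - analysisMap b ω (ω k)),
      sq_nonneg (‖V (τ k) - analysisMap b ω (τ k)‖ - ‖τ k - ω k‖)]
  refine (Finset.sum_le_sum fun k _ => hpoint k).trans_eq ?_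
  rw [Finset.sum_add_distrib, ← Finset.mul_sum, ← Finset.mul_sum, hcross]
  ring

end analysisMap

/-- Paulsen problem implies projection problem (Hilbert space case).  Suppose every
`ε`-nearly equal norm Parseval frame of `d` vectors in an `n`-dimensional real Hilbert
space admits an equal norm Parseval frame within squared distance `c`.  Then for every
`d`-dimensional real Hilbert space `H` with orthonormal basis `(u_k)` and every rank-`n`
orthogonal projection `P` with `(1-ε) n/d ≤ ‖P u_k‖² ≤ (1+ε) n/d` for all `k`, there is an
orthogonal projection `Q` with `‖Q u_k‖² = n/d` for all `k` and
`∑ k ‖P u_k - Q u_k‖² ≤ 4c`. -/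
theorem paulsen_implies_projection (ε : ℝ) (hε : ε ∈ Set.Ioo (0 : ℝ) 1)
    (n d : ℕ) (hn : 0 < n) (hnd : n ≤ d) (hd : 0 < d) (c : ℝ) (hc : 0 ≤ c)
    (hPaulsen : ∀ (K : Type) (_ : NormedAddCommGroup K), ∀ (_ : InnerProductSpace ℝ K),
      Module.finrank ℝ K = n →
      ∀ τ : Fin d → K,
        (∀ j, (1 - ε) * ((n : ℝ) / d) ≤ ‖τ j‖ ^ 2 ∧ ‖τ j‖ ^ 2 ≤ (1 + ε) * ((n : ℝ) / d)) →
        (∀ x : K, (1 - ε) * ‖x‖ ^ 2 ≤ ∑ j, ⟪x, τ j⟫ ^ 2 ∧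
          ∑ j, ⟪x, τ j⟫ ^ 2 ≤ (1 + ε) * ‖x‖ ^ 2) →
        ∃ ω : Fin d → K,
          (∀ x : K, ∑ j, ⟪x, ω j⟫ • ω j = x) ∧
          (∀ j, ‖ω j‖ ^ 2 = (n : ℝ) / d) ∧
          ∑ j, ‖τ j - ω j‖ ^ 2 ≤ c)
    {H : Type*} [NormedAddCommGroup H] [InnerProductSpace ℝ H] [FiniteDimensional ℝ H]
    (hdim : Module.finrank ℝ H = d) (u : Fin d → H) (hu : Orthonormal ℝ u)
    (P : H →ₗ[ℝ] H) (hPidem : ∀ x, P (P x) = P x)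
    (hPadj : ∀ x y : H, ⟪P x, y⟫ = ⟪x, P y⟫)
    (hPrank : Module.finrank ℝ (LinearMap.range P) = n)
    (hPnorm : ∀ k, (1 - ε) * ((n : ℝ) / d) ≤ ‖P (u k)‖ ^ 2 ∧
      ‖P (u k)‖ ^ 2 ≤ (1 + ε) * ((n : ℝ) / d)) :
    ∃ Q : H →ₗ[ℝ] H,
      (∀ x, Q (Q x) = Q x) ∧
      (∀ x y : H, ⟪Q x, y⟫ = ⟪x, Q y⟫) ∧
      (∀ k, ‖Q (u k)‖ ^ 2 = (n : ℝ) / d) ∧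
      ∑ k, ‖P (u k) - Q (u k)‖ ^ 2 ≤ 4 * c := by
  obtain ⟨b, rfl⟩ : ∃ b : OrthonormalBasis (Fin d) ℝ H, ⇑b = u := by
    have : Nonempty (Fin d) := ⟨⟨0, hd⟩⟩
    exact ⟨(basisOfOrthonormalOfCardEqFinrank hu (by simp [hdim])).toOrthonormalBasis
      (by simpa using hu), by simp⟩
  obtain ⟨V, hVP, τ, hVτ⟩ : ∃ V : EuclideanSpace ℝ (Fin n) →ₗᵢ[ℝ] H,
      (∀ x, P (V x) = V x) ∧ ∃ τ : Fin d → EuclideanSpace ℝ (Fin n),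
        ∀ k, V (τ k) = P (b k) := by
    let e : LinearMap.range P ≃ₗᵢ[ℝ] EuclideanSpace ℝ (Fin n) :=
      ((stdOrthonormalBasis ℝ (LinearMap.range P)).reindex (finCongr hPrank)).repr
    refine ⟨(LinearMap.range P).subtypeₗᵢ.comp e.symm.toLinearIsometry, fun x => ?_,
      fun k => e ⟨P (b k), LinearMap.mem_range_self P _⟩, fun k => by simp⟩
    obtain ⟨y, hy⟩ := (e.symm x).2
    change P (e.symm x : H) = (e.symm x : H)
    rw [← hy, hPidem]
  have hV (x : EuclideanSpace ℝ (Fin n)) (j : Fin d) : ⟪b j, V x⟫ = ⟪τ j, x⟫ := by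
    rw [← V.inner_map_map, hVτ, hPadj, hVP]
  have hτ (x : EuclideanSpace ℝ (Fin n)) : ∑ j, ⟪x, τ j⟫ ^ 2 = ‖x‖ ^ 2 := by
    rw [← V.norm_map, ← b.sum_sq_inner_right]
    exact Finset.sum_congr rfl fun j _ => by rw [hV, real_inner_comm]
  have hτn (k : Fin d) : ‖τ k‖ = ‖P (b k)‖ := by rw [← hVτ, V.norm_map]
  obtain ⟨ω, hω, hωn, hdist⟩ := hPaulsen (EuclideanSpace ℝ (Fin n)) inferInstance inferInstance
    (by simp) τ (fun j => by rw [hτn]; exact hPnorm j) (fun x => by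
      rw [hτ]
      constructor <;> nlinarith [mul_nonneg hε.1.le (sq_nonneg ‖x‖)])
  obtain ⟨Q, hQidem, hQadj, hQ⟩ := exists_projection_of_adjoint_leftInverse
    (analysisMap b ω) (adjoint_analysisMap_leftInverse b ω hω)
  have hQb (k : Fin d) : Q (b k) = analysisMap b ω (ω k) := by
    rw [hQ, adjoint_analysisMap_basis]
  refine ⟨Q, hQidem, hQadj, fun k => ?_, ?_⟩
  · rw [hQb, norm_analysisMap_apply b ω hω, hωn]
  · have h := sum_norm_sub_analysisMap_sq_le b ω hω τ hτ V hV
    simp only [hVτ, ← hQb] at h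
    exact h.trans (by gcongr)
end

section
/- (Kwok–Lau–Lee–Ramachandran Theorem.) There exists a universal constant C > 0 such that for every ε ∈ (0,1) and all positive natural numbers n, d, and every ε-nearly equal norm Parseval frame (τ_j)_{j=1}^n for ℝ^d, there is an equal norm Parseval frame (ω_j)_{j=1}^n for ℝ^d satisfying ∑_{j=1}^n ‖τ_j − ω_j‖² ≤ C · ε · d^{13/2}. In particular the Paulsen bound does not depend on n. -/
open Finset RealInnerProductSpace

section RadialIsotropy

open Matrix

lemma posSemidef_smul_vecMulVec {κ : Type*} [Fintype κ] {c : ℝ} (hc : 0 ≤ c) (u : κ → ℝ) :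
    (c • vecMulVec u u).PosSemidef := by
  have := (posSemidef_vecMulVec_self_star u).smul hc
  simpa using this

lemma det_add_smul_vecMulVec {κ : Type*} [Fintype κ] [DecidableEq κ] {A : Matrix κ κ ℝ}
    (hA : IsUnit A.det) (c : ℝ) (u : κ → ℝ) :
    (A + c • vecMulVec u u).det = A.det * (1 + c * (u ⬝ᵥ A⁻¹ *ᵥ u)) := by
  have h := det_add_replicateCol_mul_replicateRow (ι := Unit) hA (c • u) u
  have h1 : replicateCol Unit (c • u) * replicateRow Unit u = c • vecMulVec u u := by
    ext i j; simp [Matrix.mul_apply, vecMulVec_apply, mul_assoc]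
  rw [← h1, h]
  congr 1
  rw [det_unique, Matrix.mul_assoc, ← replicateCol_mulVec, Matrix.add_apply, Matrix.one_apply_eq,
    mulVec_smul]
  simp [Matrix.mul_apply, dotProduct, Finset.mul_sum, mul_left_comm]

lemma det_le_det_add_sum {ι κ : Type*} [Fintype κ] [DecidableEq κ] {A : Matrix κ κ ℝ}
    (hA : A.PosDef) (V : Matrix ι κ ℝ) {w : ι → ℝ} (hw : ∀ i, 0 ≤ w i) (s : Finset ι) :
    (A + ∑ i ∈ s, w i • vecMulVec (V i) (V i)).PosDef ∧
      A.det ≤ (A + ∑ i ∈ s, w i • vecMulVec (V i) (V i)).det := by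
  classical
  induction s using Finset.induction_on with
  | empty => simpa using hA
  | insert a s ha ih =>
    obtain ⟨hp, hle⟩ := ih
    rw [Finset.sum_insert ha, add_comm (w a • _), ← add_assoc]
    refine ⟨hp.add_posSemidef (posSemidef_smul_vecMulVec (hw a) _), hle.trans ?_⟩
    rw [det_add_smul_vecMulVec hp.det_pos.ne'.isUnit]
    have h1 : 0 ≤ V a ⬝ᵥ (A + ∑ i ∈ s, w i • vecMulVec (V i) (V i))⁻¹ *ᵥ V a := by
      simpa using hp.inv.posSemidef.dotProduct_mulVec_nonneg (V a)
    exact le_mul_of_one_le_right hp.det_pos.le (by nlinarith [hw a, mul_nonneg (hw a) h1])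

lemma exists_embedding_map_eq {ι κ : Type*} [Fintype κ] {s : Finset ι}
    (hs : s.card = Fintype.card κ) :
    ∃ e : κ ↪ ι, univ.map e = s := by
  have e := Fintype.equivOfCardEq (α := κ) (β := s) (by simp [hs])
  refine ⟨e.toEmbedding.trans (Function.Embedding.subtype _), ?_⟩
  rw [← Finset.map_map, Finset.map_univ_equiv]
  exact Finset.attach_map_val

variable {ι κ : Type*} [Fintype κ] [DecidableEq κ]

/-- Every choice of `card κ` distinct rows of `V` is linearly independent. -/
def IsGeneric (V : Matrix ι κ ℝ) : Prop :=
  ∀ e : κ ↪ ι, (V.submatrix e id).det ≠ 0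

lemma sum_embedding_eq (V : Matrix ι κ ℝ) (w : ι → ℝ) (e : κ ↪ ι) :
    ∑ i ∈ univ.map e, w i • vecMulVec (V i) (V i) =
      (V.submatrix e id)ᵀ * diagonal (w ∘ e) * V.submatrix e id := by
  rw [Finset.sum_map]
  ext a b
  rw [Matrix.mul_apply]
  simp only [Matrix.sum_apply, Matrix.smul_apply, vecMulVec_apply, mul_diagonal, transpose_apply,
    submatrix_apply, id, Function.comp, smul_eq_mul]
  exact Finset.sum_congr rfl fun _ _ => by ring

lemma det_sum_embedding (V : Matrix ι κ ℝ) (w : ι → ℝ) (e : κ ↪ ι) :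
    (∑ i ∈ univ.map e, w i • vecMulVec (V i) (V i)).det =
      (V.submatrix e id).det ^ 2 * ∏ j, w (e j) := by
  rw [sum_embedding_eq, det_mul, det_mul, det_transpose, det_diagonal]
  simp only [Function.comp]
  ring

lemma posDef_sum_embedding {V : Matrix ι κ ℝ} (hV : IsGeneric V) {w : ι → ℝ}
    (hw : ∀ i, 0 < w i) (e : κ ↪ ι) :
    (∑ i ∈ univ.map e, w i • vecMulVec (V i) (V i)).PosDef := by
  rw [sum_embedding_eq]
  have h := (PosDef.diagonal (n := κ) (d := w ∘ e) fun j => hw (e j)).conjTranspose_mul_mul_same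
    (B := V.submatrix e id) (mulVec_injective_of_isUnit
      ((isUnit_iff_isUnit_det _).2 (hV e).isUnit))
  simpa using h

variable [Fintype ι]

/-- The weighted frame operator `∑ i, w i • v i (v i)ᵀ` of the rows of `V`. -/
noncomputable def weightedFrameOp (V : Matrix ι κ ℝ) (w : ι → ℝ) : Matrix κ κ ℝ :=
  ∑ i, w i • vecMulVec (V i) (V i)

lemma weightedFrameOp_lower {V : Matrix ι κ ℝ} (hV : IsGeneric V) {w : ι → ℝ}
    (hw : ∀ i, 0 < w i) (e : κ ↪ ι) :
    (weightedFrameOp V w).PosDef ∧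
      (V.submatrix e id).det ^ 2 * ∏ j, w (e j) ≤ (weightedFrameOp V w).det := by
  classical
  have h := det_le_det_add_sum (posDef_sum_embedding hV hw e) V (fun i => (hw i).le)
    (univ \ univ.map e)
  rwa [add_comm, Finset.sum_sdiff (subset_univ _), det_sum_embedding] at h

/-- The logarithmic potential minimised by the scaling weights of a radial isotropic position. -/
noncomputable def scalingPotential (V : Matrix ι κ ℝ) (t : ι → ℝ) : ℝ :=
  Fintype.card ι * Real.log (weightedFrameOp V fun i => Real.exp (t i)).det
    - Fintype.card κ * ∑ i, t i

lemma log_det_weightedFrameOp_ge {V : Matrix ι κ ℝ} (hV : IsGeneric V) (t : ι → ℝ) (e : κ ↪ ι) :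
    Real.log ((V.submatrix e id).det ^ 2) + ∑ j, t (e j) ≤
      Real.log (weightedFrameOp V fun i => Real.exp (t i)).det := by
  obtain ⟨-, h⟩ := weightedFrameOp_lower hV (fun i => Real.exp_pos (t i)) e
  have h0 : 0 < (V.submatrix e id).det ^ 2 := by have := hV e; positivity
  rw [← Real.exp_sum] at h
  have := Real.log_le_log (by positivity) h
  rwa [Real.log_mul h0.ne' (Real.exp_pos _).ne', Real.log_exp] at this

lemma scalingPotential_add_const {V : Matrix ι κ ℝ} (hV : IsGeneric V) (e : κ ↪ ι)
    (t : ι → ℝ) (c : ℝ) :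
    scalingPotential V (fun i => t i + c) = scalingPotential V t := by
  have h : (weightedFrameOp V fun i => Real.exp (t i + c)) =
      Real.exp c • weightedFrameOp V fun i => Real.exp (t i) := by
    simp only [weightedFrameOp, Finset.smul_sum, smul_smul, Real.exp_add, mul_comm (Real.exp c)]
  have hp := (weightedFrameOp_lower hV (fun i => Real.exp_pos (t i)) e).1.det_pos
  simp only [scalingPotential]
  rw [h, det_smul, Real.log_mul (by positivity) hp.ne', Real.log_pow, Real.log_exp,
    Finset.sum_add_distrib]
  simp
  ring

lemma continuous_scalingPotential {V : Matrix ι κ ℝ} (hV : IsGeneric V) (e : κ ↪ ι) :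
    Continuous (scalingPotential V) := by
  unfold scalingPotential
  have h : Continuous fun t : ι → ℝ => (weightedFrameOp V fun i => Real.exp (t i)).det := by
    unfold weightedFrameOp
    fun_prop
  exact (continuous_const.mul (h.log fun t =>
    (weightedFrameOp_lower hV (fun i => Real.exp_pos (t i)) e).1.det_pos.ne')).sub (by fun_prop)

lemma exists_superlevel_finset (w : ι → ℝ) (k : ℕ) (hk : k ≤ Fintype.card ι) :
    ∃ s : Finset ι, s.card = k ∧ ∀ i ∈ s, ∀ j ∉ s, w j ≤ w i := by
  classical
  induction k with
  | zero => exact ⟨∅, by simp⟩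
  | succ k ih =>
    obtain ⟨s, hs, h⟩ := ih (by omega)
    have hne : sᶜ.Nonempty := by
      rw [← Finset.card_pos, Finset.card_compl]; omega
    obtain ⟨a, ha, hmax⟩ := Finset.exists_max_image sᶜ w hne
    refine ⟨insert a s, by rw [card_insert_of_notMem (by simpa using ha), hs], ?_⟩
    intro i hi j hj
    simp only [mem_insert, not_or] at hi hj
    rcases hi with rfl | hi
    · exact hmax j (by simpa using hj.2)
    · exact h i hi j hj.2

lemma sum_superlevel_identity [DecidableEq ι] (t : ι → ℝ) (s : Finset ι) :
    ∑ i ∈ s, ∑ j ∈ sᶜ, (t i - t j) =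
      Fintype.card ι * ∑ i ∈ s, t i - s.card * ∑ i, t i := by
  have h1 := Finset.sum_add_sum_compl s t
  have h2 : (s.card : ℝ) + (sᶜ.card : ℝ) = Fintype.card ι := by
    exact_mod_cast Finset.card_add_card_compl s
  simp only [Finset.sum_sub_distrib, Finset.sum_const, nsmul_eq_mul, ← Finset.mul_sum]
  rw [← h1, ← h2]
  ring

lemma sub_le_of_scalingPotential_le {V : Matrix ι κ ℝ} (hV : IsGeneric V)
    (hκ : 0 < Fintype.card κ) (hlt : Fintype.card κ < Fintype.card ι) {c : ℝ}
    (hc : ∀ e : κ ↪ ι, c ≤ Real.log ((V.submatrix e id).det ^ 2)) {B : ℝ} {t : ι → ℝ}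
    (ht : scalingPotential V t ≤ B) (i j : ι) :
    t i - t j ≤ B - Fintype.card ι * c := by
  classical
  obtain ⟨s, hs, htop⟩ := exists_superlevel_finset t (Fintype.card κ) hlt.le
  obtain ⟨e, he⟩ := exists_embedding_map_eq hs
  have h1 := log_det_weightedFrameOp_ge hV t e
  have h2 : ∑ i ∈ s, ∑ j ∈ sᶜ, (t i - t j) ≤ B - Fintype.card ι * c := by
    rw [sum_superlevel_identity, ← he, Finset.sum_map, he, hs]
    have h3 : (Fintype.card ι : ℝ) * (c + ∑ j, t (e j)) ≤
        Fintype.card ι * Real.log (weightedFrameOp V fun i => Real.exp (t i)).det := by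
      gcongr
      linarith [hc e]
    simp only [scalingPotential] at ht
    linarith
  have hnn : ∀ i ∈ s, ∀ j ∈ sᶜ, 0 ≤ t i - t j := fun i hi j hj =>
    sub_nonneg.2 (htop i hi j (by simpa using hj))
  have hpair : ∀ i ∈ s, ∀ j ∈ sᶜ, t i - t j ≤ B - Fintype.card ι * c := fun i hi j hj =>
    ((Finset.single_le_sum (f := fun j => t i - t j) (hnn i hi) hj).trans
      (Finset.single_le_sum (f := fun i => ∑ j ∈ sᶜ, (t i - t j))
        (fun i hi => Finset.sum_nonneg (hnn i hi)) hi)).trans h2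
  obtain ⟨p, hp⟩ : s.Nonempty := by rw [← Finset.card_pos]; omega
  obtain ⟨q, hq⟩ : sᶜ.Nonempty := by rw [← Finset.card_pos, Finset.card_compl]; omega
  by_cases hi : i ∈ s <;> by_cases hj : j ∈ s
  · linarith [hpair i hi q hq, hnn j hj q hq]
  · exact hpair i hi j (by simpa using hj)
  · linarith [hpair p hp q hq, hnn p hp q hq, hnn j hj i (by simpa using hi)]
  · linarith [hpair p hp j (by simpa using hj), hnn p hp i (by simpa using hi)]

lemma scalingPotential_eq_of_card_eq {V : Matrix ι κ ℝ} (hV : IsGeneric V)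
    (hcard : Fintype.card κ = Fintype.card ι) (e : κ ↪ ι) (t : ι → ℝ) :
    scalingPotential V t = Fintype.card ι * Real.log ((V.submatrix e id).det ^ 2) := by
  have he : univ.map e = univ := Finset.eq_univ_of_card _ (by simp [hcard])
  have h0 : 0 < (V.submatrix e id).det ^ 2 := by have := hV e; positivity
  have h1 := det_sum_embedding V (fun i => Real.exp (t i)) e
  have h2 : ∑ j, t (e j) = ∑ i, t i := by
    conv_rhs => rw [← he, Finset.sum_map]
  rw [he, ← Real.exp_sum, h2] at h1
  unfold scalingPotential weightedFrameOp
  rw [h1, Real.log_mul h0.ne' (Real.exp_pos _).ne', Real.log_exp, hcard]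
  ring

lemma exists_forall_scalingPotential_le {V : Matrix ι κ ℝ} (hV : IsGeneric V)
    (hκ : 0 < Fintype.card κ) (hle : Fintype.card κ ≤ Fintype.card ι) :
    ∃ t, ∀ t', scalingPotential V t ≤ scalingPotential V t' := by
  obtain ⟨e⟩ := Function.Embedding.nonempty_of_card_le hle
  rcases hle.eq_or_lt with hcard | hlt
  · exact ⟨0, fun t' => by simp only [scalingPotential_eq_of_card_eq hV hcard e, le_refl]⟩
  have : Nonempty (κ ↪ ι) := ⟨e⟩
  obtain ⟨e₀, hc⟩ := Finite.exists_min fun e : κ ↪ ι => Real.log ((V.submatrix e id).det ^ 2)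
  set R := scalingPotential V 0 -
    Fintype.card ι * Real.log ((V.submatrix e₀ id).det ^ 2)
  have hbound : ∀ t, scalingPotential V t ≤ scalingPotential V 0 → ∀ i j, t i - t j ≤ R :=
    fun t ht => sub_le_of_scalingPotential_le hV hκ hlt hc ht
  obtain ⟨i₀⟩ : Nonempty ι := Fintype.card_pos_iff.1 (hκ.trans hlt)
  have hR0 : 0 ≤ R := by simpa using hbound 0 le_rfl i₀ i₀
  obtain ⟨t, -, ht⟩ := (isCompact_Icc (a := fun _ : ι => -R) (b := fun _ => R)).exists_isMinOn
    ⟨0, ⟨fun i => by simpa using hR0, fun i => by simpa using hR0⟩⟩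
    (continuous_scalingPotential hV e).continuousOn
  have h0 : scalingPotential V t ≤ scalingPotential V 0 :=
    ht ⟨fun i => by simpa using hR0, fun i => by simpa using hR0⟩
  refine ⟨t, fun t' => ?_⟩
  rcases le_total (scalingPotential V 0) (scalingPotential V t') with h | h
  · exact h0.trans h
  rw [← scalingPotential_add_const hV e t' (-t' i₀)]
  exact ht ⟨fun i => by linarith [hbound t' h i₀ i], fun i => by linarith [hbound t' h i i₀]⟩

/-- At a minimiser of the potential all leverage scores coincide. -/
lemma leverage_eq_of_isMin {V : Matrix ι κ ℝ} (hV : IsGeneric V) (e : κ ↪ ι) {t : ι → ℝ}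
    (ht : ∀ t', scalingPotential V t ≤ scalingPotential V t') (i : ι) :
    Fintype.card ι * (Real.exp (t i) *
      (V i ⬝ᵥ (weightedFrameOp V fun i => Real.exp (t i))⁻¹ *ᵥ V i)) = Fintype.card κ := by
  classical
  set M := weightedFrameOp V fun i => Real.exp (t i) with hM
  have hp := (weightedFrameOp_lower hV (fun i => Real.exp_pos (t i)) e).1
  set q := Real.exp (t i) * (V i ⬝ᵥ M⁻¹ *ᵥ V i) with hq
  have hup : ∀ s : ℝ, (weightedFrameOp V fun j => Real.exp (Function.update t i (t i + s) j)) =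
      M + (Real.exp (t i) * (Real.exp s - 1)) • vecMulVec (V i) (V i) := by
    intro s
    rw [hM, weightedFrameOp, weightedFrameOp, ← Finset.add_sum_erase _ _ (mem_univ i),
      ← Finset.add_sum_erase univ (fun j => Real.exp (t j) • vecMulVec (V j) (V j)) (mem_univ i)]
    have h1 : ∑ j ∈ univ.erase i,
        Real.exp (Function.update t i (t i + s) j) • vecMulVec (V j) (V j) =
        ∑ j ∈ univ.erase i, Real.exp (t j) • vecMulVec (V j) (V j) :=
      Finset.sum_congr rfl fun j hj => by
        rw [Function.update_of_ne (Finset.ne_of_mem_erase hj)]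
    rw [h1, Function.update_self, Real.exp_add, add_right_comm, ← add_smul]
    congr 3
    ring
  have hval : ∀ s : ℝ, 1 + (Real.exp s - 1) * q ≠ 0 →
      scalingPotential V (Function.update t i (t i + s)) = scalingPotential V t +
      (Fintype.card ι * Real.log (1 + (Real.exp s - 1) * q) - Fintype.card κ * s) := by
    intro s hs
    have h1 : ∑ j, Function.update t i (t i + s) j = ∑ j, t j + s := by
      rw [Finset.sum_update_of_mem (mem_univ i), ← Finset.add_sum_erase univ t (mem_univ i),
        Finset.sdiff_singleton_eq_erase]
      ring
    simp only [scalingPotential]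
    rw [hup, det_add_smul_vecMulVec hp.det_pos.ne'.isUnit, h1,
      show 1 + Real.exp (t i) * (Real.exp s - 1) * (V i ⬝ᵥ M⁻¹ *ᵥ V i) =
        1 + (Real.exp s - 1) * q by rw [hq]; ring, Real.log_mul hp.det_pos.ne' hs]
    ring
  set f : ℝ → ℝ := fun s =>
    Fintype.card ι * Real.log (1 + (Real.exp s - 1) * q) - Fintype.card κ * s with hf
  have hmin : IsLocalMin f 0 := by
    have hev : ∀ᶠ s : ℝ in nhds 0, 1 + (Real.exp s - 1) * q ≠ 0 :=
      ContinuousAt.eventually_ne (by fun_prop) (by simp)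
    filter_upwards [hev] with s hs
    have h1 := ht (Function.update t i (t i + s))
    rw [hval s hs] at h1
    simp only [hf, Real.exp_zero, sub_self, zero_mul, add_zero, Real.log_one, mul_zero]
    linarith
  have hder : HasDerivAt f (Fintype.card ι * (Real.exp 0 * q / (1 + (Real.exp 0 - 1) * q)) -
      Fintype.card κ * 1) 0 :=
    ((((((Real.hasDerivAt_exp 0).sub_const 1).mul_const q).const_add 1).log
      (by simp)).const_mul _).sub ((hasDerivAt_id _).const_mul _)
  have := hmin.hasDerivAt_eq_zero hder
  simp at this
  linarith

end RadialIsotropy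

section Majorization

variable {κ : Type*} [Fintype κ] {p μ : κ → ℝ} {r : ℝ}

lemma sum_rescaled_sub_nonneg [DecidableEq κ] (hp : ∀ a, 0 ≤ p a) (hμ : ∀ a, 0 < μ a) (hr : 0 ≤ r)
    (hsum : ∑ a, r / μ a * p a = ∑ a, p a) (s : Finset κ)
    (hs : ∀ a ∈ s, ∀ b ∉ s, μ a ≤ μ b) : 0 ≤ ∑ a ∈ s, (r / μ a * p a - p a) := by
  by_cases h : ∀ a ∈ s, 1 ≤ r / μ a
  · exact Finset.sum_nonneg fun a ha => by nlinarith [h a ha, hp a]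
  push Not at h
  obtain ⟨a, ha, hlt⟩ := h
  have htot : ∑ a, (r / μ a * p a - p a) = 0 := by rw [Finset.sum_sub_distrib, hsum, sub_self]
  rw [← Finset.sum_add_sum_compl s] at htot
  have : ∑ b ∈ sᶜ, (r / μ b * p b - p b) ≤ 0 := Finset.sum_nonpos fun b hb => by
    have h1 : r / μ b ≤ r / μ a :=
      div_le_div_of_nonneg_left hr (hμ a) (hs a ha b (by simpa using hb))
    nlinarith [hp b]
  linarith

lemma abs_rescaled_sub_le (hp : ∀ a, 0 ≤ p a) (hμ : ∀ a, 0 < μ a) (hr : 0 ≤ r)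
    (hsum : ∑ a, r / μ a * p a = ∑ a, p a) (a : κ) :
    |r / μ a * p a - p a| ≤ ∑ b with μ b ≤ μ a, (r / μ b * p b - p b) +
      ∑ b with μ b < μ a, (r / μ b * p b - p b) := by
  classical
  have hle := sum_rescaled_sub_nonneg hp hμ hr hsum (univ.filter fun b => μ b ≤ μ a)
    fun b hb c hc => by simp at hb hc; linarith
  have hlt := sum_rescaled_sub_nonneg hp hμ hr hsum (univ.filter fun b => μ b < μ a)
    fun b hb c hc => by simp at hb hc; linarith
  rcases le_total 1 (r / μ a) with h | h
  · rw [abs_of_nonneg (by nlinarith [hp a])]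
    have : r / μ a * p a - p a ≤ ∑ b with μ b ≤ μ a, (r / μ b * p b - p b) := by
      refine Finset.single_le_sum (f := fun b => r / μ b * p b - p b) (fun b hb => ?_) (by simp)
      have h1 : r / μ a ≤ r / μ b := div_le_div_of_nonneg_left hr (hμ b) (by simpa using hb)
      nlinarith [hp b]
    linarith
  · rw [abs_of_nonpos (by nlinarith [hp a])]
    have htot : ∑ a, (r / μ a * p a - p a) = 0 := by rw [Finset.sum_sub_distrib, hsum, sub_self]
    rw [← Finset.sum_filter_add_sum_filter_not univ (fun b => μ b < μ a)] at htot
    have : -(r / μ a * p a - p a) ≤ ∑ b with ¬ μ b < μ a, -(r / μ b * p b - p b) := by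
      refine Finset.single_le_sum (f := fun b => -(r / μ b * p b - p b)) (fun b hb => ?_) (by simp)
      have h1 : r / μ b ≤ r / μ a := div_le_div_of_nonneg_left hr (hμ a) (by simpa using hb)
      nlinarith [hp b]
    rw [Finset.sum_neg_distrib] at this
    linarith

end Majorization

lemma sq_one_sub_sqrt_le (c : ℝ) (hc : 0 ≤ c) : (1 - √c) ^ 2 ≤ |c - 1| := by
  have h0 := Real.sqrt_nonneg c
  have h1 := Real.sq_sqrt hc
  rcases le_total c 1 with h | h
  · rw [abs_of_nonpos (by linarith)]; nlinarith [Real.sqrt_le_one.2 h]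
  · rw [abs_of_nonneg (by linarith)]; nlinarith [Real.one_le_sqrt.2 h]

section Rounding

open Matrix

variable {ι : Type*} [Fintype ι] {d : ℕ} {v : ι → EuclideanSpace ℝ (Fin d)}

lemma dotProduct_weightedFrameOp_mulVec (w : ι → ℝ) (x y : EuclideanSpace ℝ (Fin d)) :
    x.ofLp ⬝ᵥ weightedFrameOp (fun i a => v i a) w *ᵥ y.ofLp =
      ∑ i, w i * (⟪x, v i⟫ * ⟪y, v i⟫) := by
  unfold weightedFrameOp
  rw [Matrix.sum_mulVec, dotProduct_sum]
  refine Finset.sum_congr rfl fun i _ => ?_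
  have h : ∀ z : EuclideanSpace ℝ (Fin d), ⟪z, v i⟫ = (v i).ofLp ⬝ᵥ z.ofLp := fun z => by
    simp [EuclideanSpace.inner_eq_star_dotProduct]
  rw [h, h, smul_mulVec, vecMulVec_mulVec, dotProduct_smul, dotProduct_comm (v i).ofLp x.ofLp]
  simp [mul_comm]

lemma exists_equal_norm_parseval_of_weights {w : ι → ℝ} (hw : ∀ i, 0 < w i)
    (hM : (weightedFrameOp (fun i a => v i a) w).PosDef) {ρ δ : ℝ} (hδ : 0 ≤ δ)
    (hlev : ∀ i, w i * ((v i).ofLp ⬝ᵥ (weightedFrameOp (fun i a => v i a) w)⁻¹ *ᵥ (v i).ofLp) = ρ)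
    (hnorm : ∀ i, ‖v i‖ ^ 2 = ρ)
    (hlow : ∀ x : EuclideanSpace ℝ (Fin d), (1 - δ) * ‖x‖ ^ 2 ≤ ∑ i, ⟪x, v i⟫ ^ 2) :
    ∃ ω : ι → EuclideanSpace ℝ (Fin d),
      (∀ x : EuclideanSpace ℝ (Fin d), ∑ i, ⟪x, ω i⟫ • ω i = x) ∧
      (∀ i, ‖ω i‖ ^ 2 = ρ) ∧ ∑ i, ‖v i - ω i‖ ^ 2 ≤ 2 * δ * (d : ℝ) ^ 2 := by
  set M := weightedFrameOp (fun i a => v i a) w with hMdef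
  set b := hM.isHermitian.eigenvectorBasis
  set μ := hM.isHermitian.eigenvalues
  have hμ : ∀ a, 0 < μ a := hM.eigenvalues_pos
  have hMb : ∀ a, M *ᵥ (b a).ofLp = μ a • (b a).ofLp := hM.isHermitian.mulVec_eigenvectorBasis
  have horth : ∀ a a', ∑ i, w i * (⟪b a, v i⟫ * ⟪b a', v i⟫) = if a = a' then μ a else 0 := by
    intro a a'
    rw [← dotProduct_weightedFrameOp_mulVec, ← hMdef, hMb, dotProduct_smul]
    have := orthonormal_iff_ite.1 b.orthonormal a' a
    rw [EuclideanSpace.inner_eq_star_dotProduct] at this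
    simp only [star_trivial] at this
    rw [this]
    by_cases h : a = a' <;> simp [h, eq_comm]
  have hinv : ∀ x : EuclideanSpace ℝ (Fin d),
      M⁻¹ *ᵥ x.ofLp = (∑ a, ((μ a)⁻¹ * ⟪b a, x⟫) • b a).ofLp := by
    intro x
    have h1 : M *ᵥ (∑ a, ((μ a)⁻¹ * ⟪b a, x⟫) • b a).ofLp = x.ofLp := by
      conv_rhs => rw [← b.sum_repr' x]
      simp only [WithLp.ofLp_sum, WithLp.ofLp_smul, Matrix.mulVec_sum, mulVec_smul, hMb, smul_smul]
      refine Finset.sum_congr rfl fun a _ => ?_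
      rw [mul_right_comm, inv_mul_cancel₀ (hμ a).ne', one_mul]
    conv_lhs => rw [← h1, mulVec_mulVec, nonsing_inv_mul _ hM.det_pos.ne'.isUnit, one_mulVec]
  have hquad : ∀ i, ∑ a, w i / μ a * ⟪b a, v i⟫ ^ 2 = ρ := by
    intro i
    have h1 : (v i).ofLp ⬝ᵥ M⁻¹ *ᵥ (v i).ofLp = ∑ a, (μ a)⁻¹ * ⟪b a, v i⟫ ^ 2 := by
      rw [hinv]
      have h2 := EuclideanSpace.inner_eq_star_dotProduct (∑ a, ((μ a)⁻¹ * ⟪b a, v i⟫) • b a) (v i)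
      rw [star_trivial] at h2
      rw [← h2, sum_inner]
      refine Finset.sum_congr rfl fun a _ => ?_
      rw [real_inner_smul_left, pow_two, mul_assoc]
    rw [← hlev i, h1, Finset.mul_sum]
    exact Finset.sum_congr rfl fun a _ => by rw [div_eq_mul_inv, mul_assoc]
  have hsq : ∀ i, ∑ a, ⟪b a, v i⟫ ^ 2 = ρ := fun i => by
    rw [← hnorm i, ← b.sum_sq_norm_inner_right (v i)]
    simp
  let ω : ι → EuclideanSpace ℝ (Fin d) := fun i =>
    ∑ a, (√(w i / μ a) * ⟪b a, v i⟫) • b a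
  have hωb : ∀ i a, ⟪b a, ω i⟫ = √(w i / μ a) * ⟪b a, v i⟫ := fun i a =>
    b.orthonormal.inner_right_fintype _ a
  have hnn : ∀ i a, 0 ≤ w i / μ a := fun i a => (div_pos (hw i) (hμ a)).le
  have hωorth : ∀ a a', ∑ i, ⟪b a, ω i⟫ * ⟪b a', ω i⟫ = if a = a' then 1 else 0 := by
    intro a a'
    have h1 : ∀ i, ⟪b a, ω i⟫ * ⟪b a', ω i⟫ =
        (√(μ a) * √(μ a'))⁻¹ * (w i * (⟪b a, v i⟫ * ⟪b a', v i⟫)) := by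
      intro i
      rw [hωb, hωb, Real.sqrt_div (hw i).le, Real.sqrt_div (hw i).le]
      have ha := (Real.sqrt_pos.2 (hμ a)).ne'
      have ha' := (Real.sqrt_pos.2 (hμ a')).ne'
      field_simp
      rw [Real.sq_sqrt (hw i).le]
      ring
    simp only [h1, ← Finset.mul_sum, horth]
    split_ifs with h
    · subst h
      rw [Real.mul_self_sqrt (hμ a).le, inv_mul_cancel₀ (hμ a).ne']
    · simp
  refine ⟨ω, fun x => ?_, fun i => ?_, ?_⟩
  · refine b.repr.injective (PiLp.ext fun a => ?_)
    rw [b.repr_apply_apply, b.repr_apply_apply, inner_sum]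
    have h1 : ∀ i, ⟪x, ω i⟫ = ∑ a', ⟪x, b a'⟫ * ⟪b a', ω i⟫ :=
      fun i => (b.sum_inner_mul_inner x (ω i)).symm
    simp only [inner_smul_right, h1, Finset.sum_mul]
    rw [Finset.sum_comm]
    simp only [mul_assoc, ← Finset.mul_sum, hωorth]
    simp [real_inner_comm]
  · rw [← b.sum_sq_norm_inner_right (ω i), ← hquad i]
    refine Finset.sum_congr rfl fun a _ => ?_
    rw [hωb, Real.norm_eq_abs, sq_abs, mul_pow, Real.sq_sqrt (hnn i a)]
  · have hdist : ∀ i, ‖v i - ω i‖ ^ 2 ≤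
        ∑ a, |w i / μ a * ⟪b a, v i⟫ ^ 2 - ⟪b a, v i⟫ ^ 2| := by
      intro i
      rw [← b.sum_sq_norm_inner_right (v i - ω i)]
      refine Finset.sum_le_sum fun a _ => ?_
      rw [inner_sub_right, hωb, Real.norm_eq_abs, sq_abs, ← sub_one_mul, abs_mul,
        abs_of_nonneg (sq_nonneg ⟪b a, v i⟫), ← one_sub_mul, mul_pow]
      gcongr
      exact sq_one_sub_sqrt_le _ (hnn i a)
    have hcol : ∀ a, ∑ i, (w i / μ a * ⟪b a, v i⟫ ^ 2 - ⟪b a, v i⟫ ^ 2) ≤ δ := by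
      intro a
      have h1 := hωorth a a
      have h2 := hlow (b a)
      simp only [hωb, if_true] at h1
      have h3 : ∀ i, w i / μ a * ⟪b a, v i⟫ ^ 2 =
          √(w i / μ a) * ⟪b a, v i⟫ * (√(w i / μ a) * ⟪b a, v i⟫) := fun i => by
        conv_lhs => rw [← Real.mul_self_sqrt (hnn i a)]
        ring
      rw [Finset.sum_sub_distrib]
      simp only [h3, h1]
      simp at h2
      linarith
    have hset : ∀ s : Finset (Fin d),
        ∑ i, ∑ a ∈ s, (w i / μ a * ⟪b a, v i⟫ ^ 2 - ⟪b a, v i⟫ ^ 2) ≤ δ * d := by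
      intro s
      rw [Finset.sum_comm]
      refine (Finset.sum_le_card_nsmul s _ δ fun a _ => hcol a).trans ?_
      rw [nsmul_eq_mul, mul_comm]
      gcongr
      simpa using Finset.card_le_univ s
    calc ∑ i, ‖v i - ω i‖ ^ 2
        ≤ ∑ i, ∑ a, |w i / μ a * ⟪b a, v i⟫ ^ 2 - ⟪b a, v i⟫ ^ 2| :=
          Finset.sum_le_sum fun i _ => hdist i
      _ = ∑ a, ∑ i, |w i / μ a * ⟪b a, v i⟫ ^ 2 - ⟪b a, v i⟫ ^ 2| := Finset.sum_comm
      _ ≤ ∑ _a : Fin d, (δ * d + δ * d) := by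
          refine Finset.sum_le_sum fun a _ => ?_
          refine (Finset.sum_le_sum fun i _ => abs_rescaled_sub_le
            (p := fun a => ⟪b a, v i⟫ ^ 2) (fun a => sq_nonneg _) hμ (hw i).le
            ((hquad i).trans (hsq i).symm) a).trans ?_
          rw [Finset.sum_add_distrib]
          exact add_le_add (hset _) (hset _)
      _ = 2 * δ * (d : ℝ) ^ 2 := by simp; ring

end Rounding

section Perturbation

open Matrix Filter Topology

lemma eventually_eval_ne_zero {P : Polynomial ℝ} (hP : P ≠ 0) (x : ℝ) :
    ∀ᶠ s in 𝓝[≠] x, P.eval s ≠ 0 := by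
  have hfin : {s | P.IsRoot s}.Finite := Polynomial.finite_setOfPred_isRoot hP
  have h := (hfin.subset (Set.sdiff_subset (t := {x}))).isClosed.isOpen_compl.mem_nhds
    (show x ∈ ({s | P.IsRoot s} \ {x})ᶜ by simp)
  filter_upwards [nhdsWithin_le_nhds h, self_mem_nhdsWithin] with s hs hsx h0
  exact hs ⟨h0, hsx⟩

lemma eventually_isGeneric_add_momentCurve {n d : ℕ} (V : Matrix (Fin n) (Fin d) ℝ) :
    ∀ᶠ s in 𝓝[≠] (0 : ℝ), IsGeneric fun i a => V i a + s * (i : ℝ) ^ (a : ℕ) := by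
  refine eventually_all.2 fun e => ?_
  set A : Matrix (Fin d) (Fin d) ℝ := vandermonde fun j => ((e j : Fin n) : ℝ) with hA
  set B := V.submatrix e id with hB
  set P := det ((Polynomial.X : Polynomial ℝ) • A.map Polynomial.C + B.map Polynomial.C) with hPdef
  have hP : P ≠ 0 := by
    intro h
    have h1 := Polynomial.coeff_det_X_add_C_card A B
    rw [← hPdef, h, Polynomial.coeff_zero] at h1
    refine det_vandermonde_ne_zero_iff.2 ?_ h1.symm
    intro j k hjk
    exact e.injective (Fin.ext (Nat.cast_injective hjk))
  filter_upwards [eventually_eval_ne_zero hP 0] with s hs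
  convert hs using 1
  rw [hPdef, ← Polynomial.coe_evalRingHom, RingHom.map_det]
  congr 1
  ext j a
  simp [hA, hB, vandermonde_apply, add_comm]
  rfl

lemma IsGeneric.smul_rows {ι κ : Type*} [Fintype κ] [DecidableEq κ] {V : Matrix ι κ ℝ}
    (hV : IsGeneric V) {c : ι → ℝ} (hc : ∀ i, c i ≠ 0) : IsGeneric fun i a => c i * V i a := by
  intro e
  have h := det_mul_column (fun j => c (e j)) (V.submatrix e id)
  change (Matrix.of fun j a => c (e j) * V.submatrix e id j a).det ≠ 0
  rw [h]
  exact mul_ne_zero (Finset.prod_ne_zero_iff.2 fun j _ => hc _) (hV e)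

lemma exists_isGeneric_near {n d : ℕ} {v : Fin n → EuclideanSpace ℝ (Fin d)} {ρ η : ℝ}
    (hρ : 0 < ρ) (hη : 0 < η) (hv : ∀ i, ‖v i‖ ^ 2 = ρ) :
    ∃ u : Fin n → EuclideanSpace ℝ (Fin d), IsGeneric (fun i a => u i a) ∧
      (∀ i, ‖u i‖ ^ 2 = ρ) ∧ ∑ i, ‖u i - v i‖ ≤ η := by
  have hv' : ∀ i, ‖v i‖ = √ρ := fun i => by rw [← hv i, Real.sqrt_sq (norm_nonneg _)]
  have hρ' := Real.sqrt_pos.2 hρ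
  let γ : Fin n → EuclideanSpace ℝ (Fin d) := fun i => WithLp.toLp 2 fun a => (i : ℝ) ^ (a : ℕ)
  let u : ℝ → Fin n → EuclideanSpace ℝ (Fin d) := fun s i =>
    (√ρ / ‖v i + s • γ i‖) • (v i + s • γ i)
  have hne : ∀ᶠ s in 𝓝 (0 : ℝ), ∀ i, ‖v i + s • γ i‖ ≠ 0 := by
    refine eventually_all.2 fun i => ContinuousAt.eventually_ne (by fun_prop) ?_
    simp only [zero_smul, add_zero, hv' i]
    exact hρ'.ne'
  have hcont : ContinuousAt (fun s => ∑ i, ‖u s i - v i‖) 0 := by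
    refine tendsto_finsetSum _ fun i _ => ?_
    have h0 : ‖v i + (0 : ℝ) • γ i‖ ≠ 0 := hne.self_of_nhds i
    have h1 : ContinuousAt (fun s : ℝ => √ρ / ‖v i + s • γ i‖) 0 :=
      continuousAt_const.div (by fun_prop) h0
    have h2 : ContinuousAt (fun s => ‖u s i - v i‖) 0 :=
      ((h1.smul (by fun_prop)).sub continuousAt_const).norm
    exact h2
  have hsmall : ∀ᶠ s in 𝓝 (0 : ℝ), ∑ i, ‖u s i - v i‖ < η := by
    refine hcont.eventually_lt continuousAt_const ?_
    simpa [u, hv', hρ'.ne'] using hη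
  obtain ⟨s, hg, hs, hn⟩ := ((eventually_isGeneric_add_momentCurve fun i a => v i a).and
    ((hsmall.filter_mono nhdsWithin_le_nhds).and (hne.filter_mono nhdsWithin_le_nhds))).exists
  refine ⟨u s, ?_, fun i => ?_, hs.le⟩
  · exact hg.smul_rows (c := fun i => √ρ / ‖v i + s • γ i‖) fun i => div_ne_zero hρ'.ne' (hn i)
  · simp only [u]
    rw [norm_smul, norm_div, norm_norm, div_mul_cancel₀ _ (hn i), Real.norm_eq_abs, sq_abs,
      Real.sq_sqrt hρ.le]

end Perturbation

lemma card_le_of_frame_lower_bound {n d : ℕ} {τ : Fin n → EuclideanSpace ℝ (Fin d)} {c : ℝ}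
    (hc : 0 < c) (h : ∀ x : EuclideanSpace ℝ (Fin d), c * ‖x‖ ^ 2 ≤ ∑ j, ⟪x, τ j⟫ ^ 2) :
    d ≤ n := by
  let f : EuclideanSpace ℝ (Fin d) →ₗ[ℝ] (Fin n → ℝ) :=
    LinearMap.pi fun j => (innerₛₗ ℝ (τ j))
  have hf : Function.Injective f := by
    refine (injective_iff_map_eq_zero f).2 fun x hx => ?_
    have h1 : ∀ j, ⟪x, τ j⟫ = 0 := fun j => by
      rw [real_inner_comm]; exact congrFun hx j
    have h2 := h x
    simp only [h1] at h2
    have h3 : ‖x‖ ^ 2 = 0 := le_antisymm (by simp at h2; nlinarith [sq_nonneg ‖x‖]) (sq_nonneg _)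
    simpa using h3
  simpa using LinearMap.finrank_le_finrank_of_injective hf

/-- Generic equal norm frames with lower frame bound `1 - δ` are close to equal norm
Parseval frames. -/
lemma exists_equal_norm_parseval_of_isGeneric {n d : ℕ} (hd : 0 < d) (hdn : d ≤ n)
    {v : Fin n → EuclideanSpace ℝ (Fin d)} (hv : IsGeneric fun i a => v i a)
    (hnorm : ∀ i, ‖v i‖ ^ 2 = (d : ℝ) / n) {δ : ℝ} (hδ : 0 ≤ δ)
    (hlow : ∀ x : EuclideanSpace ℝ (Fin d), (1 - δ) * ‖x‖ ^ 2 ≤ ∑ i, ⟪x, v i⟫ ^ 2) :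
    ∃ ω : Fin n → EuclideanSpace ℝ (Fin d),
      (∀ x : EuclideanSpace ℝ (Fin d), ∑ i, ⟪x, ω i⟫ • ω i = x) ∧
      (∀ i, ‖ω i‖ ^ 2 = (d : ℝ) / n) ∧ ∑ i, ‖v i - ω i‖ ^ 2 ≤ 2 * δ * (d : ℝ) ^ 2 := by
  obtain ⟨t, ht⟩ := exists_forall_scalingPotential_le hv (by simpa) (by simpa)
  let e := Fin.castLEEmb hdn
  refine exists_equal_norm_parseval_of_weights (fun i => Real.exp_pos (t i))
    (weightedFrameOp_lower hv (fun i => Real.exp_pos (t i)) e).1 hδ (fun i => ?_) hnorm hlow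
  have h := leverage_eq_of_isMin hv e ht i
  simp only [Fintype.card_fin] at h
  have hn : (n : ℝ) ≠ 0 := by exact_mod_cast (hd.trans_le hdn).ne'
  rw [eq_div_iff hn, mul_comm]
  exact h

lemma frame_lower_bound_of_near {ι E : Type*} [Fintype ι] [NormedAddCommGroup E]
    [InnerProductSpace ℝ E] {u v : ι → E} {r η c : ℝ} (hu : ∀ i, ‖u i‖ = r) (hv : ∀ i, ‖v i‖ = r)
    (hr : 0 ≤ r) (huv : ∑ i, ‖u i - v i‖ ≤ η) (x : E) (hx : c * ‖x‖ ^ 2 ≤ ∑ i, ⟪x, v i⟫ ^ 2) :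
    (c - 2 * r * η) * ‖x‖ ^ 2 ≤ ∑ i, ⟪x, u i⟫ ^ 2 := by
  have h1 : ∀ i, ⟪x, v i⟫ ^ 2 - ⟪x, u i⟫ ^ 2 ≤ 2 * r * ‖x‖ ^ 2 * ‖u i - v i‖ := by
    intro i
    have e1 : ⟪x, v i⟫ ^ 2 - ⟪x, u i⟫ ^ 2 = ⟪x, v i - u i⟫ * ⟪x, v i + u i⟫ := by
      rw [inner_sub_right, inner_add_right]; ring
    rw [e1]
    calc ⟪x, v i - u i⟫ * ⟪x, v i + u i⟫ ≤ |⟪x, v i - u i⟫| * |⟪x, v i + u i⟫| := by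
          rw [← abs_mul]; exact le_abs_self _
      _ ≤ (‖x‖ * ‖v i - u i‖) * (‖x‖ * (r + r)) := by
          gcongr
          · exact abs_real_inner_le_norm _ _
          · refine (abs_real_inner_le_norm _ _).trans ?_
            gcongr
            exact (norm_add_le _ _).trans (by rw [hu, hv])
      _ = 2 * r * ‖x‖ ^ 2 * ‖u i - v i‖ := by rw [norm_sub_rev]; ring
  have h2 := Finset.sum_le_sum fun i (_ : i ∈ univ) => h1 i
  rw [Finset.sum_sub_distrib, ← Finset.mul_sum] at h2
  have h3 : 2 * r * ‖x‖ ^ 2 * ∑ i, ‖u i - v i‖ ≤ 2 * r * ‖x‖ ^ 2 * η := by gcongr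
  linarith

lemma sum_norm_sq_sub_le_of_norm_eq {ι E : Type*} [Fintype ι] [NormedAddCommGroup E]
    {u v : ι → E} {r η : ℝ} (hu : ∀ i, ‖u i‖ = r) (hv : ∀ i, ‖v i‖ = r)
    (hr : 0 ≤ r) (huv : ∑ i, ‖u i - v i‖ ≤ η) : ∑ i, ‖u i - v i‖ ^ 2 ≤ 2 * r * η := by
  calc ∑ i, ‖u i - v i‖ ^ 2 ≤ ∑ i, 2 * r * ‖u i - v i‖ := by
        refine Finset.sum_le_sum fun i _ => ?_
        rw [pow_two]
        gcongr
        exact (norm_sub_le _ _).trans (by rw [hu, hv, two_mul])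
    _ ≤ 2 * r * η := by rw [← Finset.mul_sum]; gcongr

/-- Rescaling all vectors of a nearly equal norm Parseval frame to the same norm. -/
lemma exists_equal_norm_rescaling {n d : ℕ} (hn : 0 < n) (hd : 0 < d) {ε : ℝ}
    (hε0 : 0 < ε) (hε1 : ε < 1) {τ : Fin n → EuclideanSpace ℝ (Fin d)}
    (hnorm : ∀ j, (1 - ε) * ((d : ℝ) / n) ≤ ‖τ j‖ ^ 2 ∧ ‖τ j‖ ^ 2 ≤ (1 + ε) * ((d : ℝ) / n))
    (hlow : ∀ x : EuclideanSpace ℝ (Fin d), (1 - ε) * ‖x‖ ^ 2 ≤ ∑ j, ⟪x, τ j⟫ ^ 2) :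
    ∃ v : Fin n → EuclideanSpace ℝ (Fin d), (∀ j, ‖v j‖ ^ 2 = (d : ℝ) / n) ∧
      (∀ x : EuclideanSpace ℝ (Fin d), (1 - 2 * ε) * ‖x‖ ^ 2 ≤ ∑ j, ⟪x, v j⟫ ^ 2) ∧
      ∑ j, ‖τ j - v j‖ ^ 2 ≤ ε * d := by
  set ρ : ℝ := (d : ℝ) / n with hρdef
  have hn' : (0 : ℝ) < n := by exact_mod_cast hn
  have hρ : 0 < ρ := div_pos (by exact_mod_cast hd) hn'
  have hτ : ∀ j, 0 < ‖τ j‖ ^ 2 := fun j =>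
    (mul_pos (by linarith) hρ).trans_le (hnorm j).1
  have hτ' : ∀ j, 0 < ‖τ j‖ := fun j => by
    have := hτ j
    exact (norm_nonneg _).lt_of_ne' fun h => by simp [h] at this
  have hsq := Real.sq_sqrt hρ.le
  refine ⟨fun j => (√ρ / ‖τ j‖) • τ j, fun j => ?_, fun x => ?_, ?_⟩
  · rw [norm_smul, norm_div, norm_norm, div_mul_cancel₀ _ (hτ' j).ne', Real.norm_eq_abs, sq_abs,
      hsq]
  · have h1 : ∀ j, (1 - ε) * ⟪x, τ j⟫ ^ 2 ≤ ⟪x, (√ρ / ‖τ j‖) • τ j⟫ ^ 2 := by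
      intro j
      rw [real_inner_smul_right, mul_pow, div_pow, hsq]
      gcongr
      rw [le_div_iff₀ (hτ j)]
      nlinarith [(hnorm j).2, mul_nonneg hρ.le (sq_nonneg ε)]
    have h2 := Finset.sum_le_sum fun j (_ : j ∈ univ) => h1 j
    rw [← Finset.mul_sum] at h2
    nlinarith [hlow x, mul_nonneg (sq_nonneg ε) (sq_nonneg ‖x‖)]
  · have h1 : ∀ j, ‖τ j - (√ρ / ‖τ j‖) • τ j‖ ^ 2 ≤ ε * ρ := by
      intro j
      have e1 : τ j - (√ρ / ‖τ j‖) • τ j = (1 - √ρ / ‖τ j‖) • τ j := by rw [sub_smul, one_smul]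
      have e2 : ‖τ j - (√ρ / ‖τ j‖) • τ j‖ ^ 2 = (‖τ j‖ - √ρ) ^ 2 := by
        rw [e1, norm_smul, mul_pow, Real.norm_eq_abs, sq_abs, ← mul_pow, sub_mul, one_mul,
          div_mul_cancel₀ _ (hτ' j).ne']
      rw [e2]
      have h3 := Real.sqrt_nonneg ρ
      rcases le_total (√ρ) ‖τ j‖ with h | h
      · nlinarith [(hnorm j).2]
      · nlinarith [(hnorm j).1, hτ' j]
    calc ∑ j, ‖τ j - (√ρ / ‖τ j‖) • τ j‖ ^ 2 ≤ ∑ _j : Fin n, ε * ρ :=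
          Finset.sum_le_sum fun j _ => h1 j
      _ = ε * d := by
          rw [Finset.sum_const, card_univ, Fintype.card_fin, nsmul_eq_mul, hρdef]
          field_simp

lemma norm_sub_sq_le_three {E : Type*} [NormedAddCommGroup E] (a b c e : E) :
    ‖a - e‖ ^ 2 ≤ 3 * (‖a - b‖ ^ 2 + ‖b - c‖ ^ 2 + ‖c - e‖ ^ 2) := by
  have h : ‖a - e‖ ≤ ‖a - b‖ + ‖b - c‖ + ‖c - e‖ := by
    calc ‖a - e‖ = ‖(a - b) + (b - c) + (c - e)‖ := by congr 1; abel
      _ ≤ _ := norm_add₃_le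
  nlinarith [norm_nonneg (a - e), sq_nonneg (‖a - b‖ - ‖b - c‖), sq_nonneg (‖b - c‖ - ‖c - e‖),
    sq_nonneg (‖a - b‖ - ‖c - e‖)]

/-- Kwok–Lau–Lee–Ramachandran Theorem: there is a universal constant `C > 0` such that
every `ε`-nearly equal norm Parseval frame `(τ_j)_{j=1}^n` for `ℝ^d` (with `ε ∈ (0,1)`,
`n, d > 0`) has an equal norm Parseval frame `(ω_j)_{j=1}^n` with
`∑ j ‖τ_j - ω_j‖² ≤ C ε d^{13/2}`; in particular the bound does not depend on `n`. -/
theorem kwok_lau_lee_ramachandran :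
    ∃ C : ℝ, 0 < C ∧
      ∀ (ε : ℝ), ε ∈ Set.Ioo (0 : ℝ) 1 →
      ∀ (n d : ℕ), 0 < n → 0 < d →
      ∀ τ : Fin n → EuclideanSpace ℝ (Fin d),
        (∀ j, (1 - ε) * ((d : ℝ) / n) ≤ ‖τ j‖ ^ 2 ∧ ‖τ j‖ ^ 2 ≤ (1 + ε) * ((d : ℝ) / n)) →
        (∀ x : EuclideanSpace ℝ (Fin d),
          (1 - ε) * ‖x‖ ^ 2 ≤ ∑ j, ⟪x, τ j⟫ ^ 2 ∧
          ∑ j, ⟪x, τ j⟫ ^ 2 ≤ (1 + ε) * ‖x‖ ^ 2) →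
        ∃ ω : Fin n → EuclideanSpace ℝ (Fin d),
          (∀ x : EuclideanSpace ℝ (Fin d), ∑ j, ⟪x, ω j⟫ • ω j = x) ∧
          (∀ j, ‖ω j‖ ^ 2 = (d : ℝ) / n) ∧
          ∑ j, ‖τ j - ω j‖ ^ 2 ≤ C * ε * (d : ℝ) ^ ((13 : ℝ) / 2) := by
  refine ⟨24, by norm_num, fun ε hε n d hn hd τ hnorm hframe => ?_⟩
  obtain ⟨hε0, hε1⟩ := hε
  have hdn : d ≤ n := card_le_of_frame_lower_bound (sub_pos.2 hε1) fun x => (hframe x).1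
  have hd1 : (1 : ℝ) ≤ d := by exact_mod_cast hd
  have hρ : (0 : ℝ) < (d : ℝ) / n := div_pos (by exact_mod_cast hd) (by exact_mod_cast hn)
  obtain ⟨v, hv, hvlow, hτv⟩ :=
    exists_equal_norm_rescaling hn hd hε0 hε1 hnorm fun x => (hframe x).1
  set r := √((d : ℝ) / n) with hr
  have hr0 : 0 < r := Real.sqrt_pos.2 hρ
  obtain ⟨u, hugen, hu, huv⟩ := exists_isGeneric_near (η := ε / (2 * r)) hρ (by positivity) hv
  have hη : 2 * r * (ε / (2 * r)) = ε := by field_simp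
  have hvr : ∀ i, ‖v i‖ = r := fun i => by rw [hr, ← hv i, Real.sqrt_sq (norm_nonneg _)]
  have hur : ∀ i, ‖u i‖ = r := fun i => by rw [hr, ← hu i, Real.sqrt_sq (norm_nonneg _)]
  obtain ⟨ω, hpars, hω, huω⟩ := exists_equal_norm_parseval_of_isGeneric (δ := 3 * ε) hd hdn
    hugen hu (by positivity) fun x => by
      have := frame_lower_bound_of_near hur hvr hr0.le huv x (hvlow x)
      rw [hη] at this
      linarith
  refine ⟨ω, hpars, hω, ?_⟩
  have hdist := sum_norm_sq_sub_le_of_norm_eq hur hvr hr0.le huv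
  rw [hη] at hdist
  simp only [norm_sub_rev (u _) (v _)] at hdist
  have hpow : (d : ℝ) ^ 2 ≤ (d : ℝ) ^ ((13 : ℝ) / 2) := by
    rw [← Real.rpow_natCast]
    exact Real.rpow_le_rpow_of_exponent_le hd1 (by norm_num)
  calc ∑ j, ‖τ j - ω j‖ ^ 2
      ≤ ∑ j, 3 * (‖τ j - v j‖ ^ 2 + ‖v j - u j‖ ^ 2 + ‖u j - ω j‖ ^ 2) :=
        Finset.sum_le_sum fun j _ => norm_sub_sq_le_three _ _ _ _
    _ = 3 * (∑ j, ‖τ j - v j‖ ^ 2 + ∑ j, ‖v j - u j‖ ^ 2 + ∑ j, ‖u j - ω j‖ ^ 2) := by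
        rw [← Finset.mul_sum, Finset.sum_add_distrib, Finset.sum_add_distrib]
    _ ≤ 3 * (ε * d + ε + 2 * (3 * ε) * (d : ℝ) ^ 2) := by gcongr
    _ ≤ 24 * ε * (d : ℝ) ^ 2 := by
        nlinarith [mul_nonneg hε0.le (sub_nonneg.2 hd1),
          mul_nonneg (mul_nonneg hε0.le (sub_nonneg.2 hd1)) (zero_le_one.trans hd1)]
    _ ≤ 24 * ε * (d : ℝ) ^ ((13 : ℝ) / 2) := by gcongr
end
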